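/- arXiv:1910.13250 — 2 statements merged into one kernel-verified Lean document; each statement's English description precedes it below -/
import Mathlib

section
/- Let Γ₁, Γ₂ be semigroups of nonzero algebraic quaternions each generated by finitely many elements of norm greater than 1, with Γ₁ commutative, and fix nonzero algebraic quaternions a, a', b, b'. Then the equation a f a' + b g b' = 1 has only finitely many solutions with f ∈ Γ₁ and g ∈ Γ₂. -/
open Quaternion

/-- A quaternion is algebraic if all four of its coordinates are algebraic over `ℚ`. -/
def AlgQuat (q : ℍ[ℝ]) : Prop :=
  IsAlgebraic ℚ q.re ∧ IsAlgebraic ℚ q.imI ∧ IsAlgebraic ℚ q.imJ ∧ IsAlgebraic ℚ q.imK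

section Helpers
open Polynomial

lemma ap_dvd (q n : ℕ) (a : ℤ) :
    ((n.factorial : ℕ) : ℤ) ∣ (q:ℤ)^n * ∏ h ∈ Finset.range n, (a - q * h) := by
  rw [Int.natCast_dvd, Nat.dvd_iff_prime_pow_dvd_dvd]
  intro p k hp hk
  rw [← Int.natCast_dvd]
  by_cases hpq : p ∣ q
  · have hkn : k ≤ n := by
      have := Fact.mk hp
      have h1 := sub_one_mul_padicValNat_factorial (p := p) n
      have h2 : k ≤ padicValNat p n.factorial :=
        (padicValNat_dvd_iff_le (Nat.factorial_ne_zero n)).1 hk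
      have h3 : 1 ≤ p - 1 := by have := hp.two_le; omega
      have h4 : padicValNat p n.factorial ≤ (p-1) * padicValNat p n.factorial :=
        Nat.le_mul_of_pos_left _ h3
      omega
    apply Dvd.dvd.mul_right
    have : p ^ k ∣ q ^ n := (pow_dvd_pow p hkn).trans (pow_dvd_pow_of_dvd hpq n)
    exact_mod_cast this
  · apply Dvd.dvd.mul_left
    have hc : IsCoprime (((p^k : ℕ)) : ℤ) (q : ℤ) := by
      rw [Nat.isCoprime_iff_coprime]
      exact Nat.Coprime.pow_left _ ((Nat.Prime.coprime_iff_not_dvd hp).2 hpq)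
    obtain ⟨x, y, hxy⟩ := hc
    have hcy : IsCoprime (((p^k : ℕ)) : ℤ) (y ^ n) := by
      apply IsCoprime.pow_right
      exact ⟨x, q, by linarith⟩
    apply hcy.dvd_of_dvd_mul_left
    have e1 : y ^ n * ∏ h ∈ Finset.range n, (a - q * h) =
        ∏ h ∈ Finset.range n, (y * a - h + (p^k:ℕ) * (x * h)) := by
      rw [← Finset.card_range n, ← Finset.prod_const, Finset.card_range, ← Finset.prod_mul_distrib]
      apply Finset.prod_congr rfl
      intro h _
      linear_combination (-(h:ℤ)) * hxy
    rw [e1]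
    have e2 : (∏ h ∈ Finset.range n, (y * a - h + (p^k:ℕ) * (x * h))) ≡
        ∏ h ∈ Finset.range n, (y * a - h) [ZMOD (p^k:ℕ)] := by
      apply Int.ModEq.prod
      intro h _
      simp [Int.modEq_iff_dvd]
    rw [Int.ModEq.dvd_iff e2]
    have e3 : (∏ h ∈ Finset.range n, (y * a - (h:ℤ))) = (n.factorial : ℤ) * Ring.choose (y*a) n := by
      have := Ring.descPochhammer_eq_factorial_smul_choose (y*a) n
      rw [nsmul_eq_mul] at this
      rw [← this, ← Polynomial.eval_eq_smeval, descPochhammer_eval_eq_prod_range]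
    rw [e3]
    exact Dvd.dvd.mul_right (by exact_mod_cast hk) _


lemma op_dvd (p : ℤ[X]) (t : ℕ) (μ : ℤ) (h : (X - 1 : ℤ[X])^(t+1) ∣ p) :
    (X - 1 : ℤ[X])^t ∣ X * derivative p - C μ * p := by
  obtain ⟨r, rfl⟩ := h
  refine ⟨X * (((t:ℤ[X])+1) * r + (X-1) * derivative r) - C μ * ((X-1) * r), ?_⟩
  rw [derivative_mul, derivative_pow]
  simp
  ring

lemma op_coeff (p : ℤ[X]) (μ : ℤ) (ν : ℕ) :
    (X * derivative p - C μ * p).coeff ν = ((ν:ℤ) - μ) * p.coeff ν := by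
  rw [coeff_sub, coeff_C_mul]
  cases ν with
  | zero => simp
  | succ m => rw [coeff_X_mul, coeff_derivative]; push_cast; ring

lemma op_fin {ι : Type*} [DecidableEq ι] (T : Finset ι) (μ : ι → ℤ) : ∀ (t : ℕ) (p : ℤ[X]),
    (X - 1 : ℤ[X])^(t + T.card) ∣ p → ∃ g : ℤ[X], (X-1 : ℤ[X])^t ∣ g ∧
      ∀ ν : ℕ, g.coeff ν = (∏ i ∈ T, ((ν:ℤ) - μ i)) * p.coeff ν := by
  induction T using Finset.induction_on with
  | empty => intro t p h; exact ⟨p, by simpa using h, by simp⟩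
  | insert a T ha ih =>
    intro t p h
    rw [Finset.card_insert_of_notMem ha, ← add_assoc] at h
    obtain ⟨g, hg, hc⟩ := ih t _ (op_dvd p (t + T.card) (μ a) h)
    refine ⟨g, hg, fun ν => ?_⟩
    rw [hc, op_coeff, Finset.prod_insert ha]; ring

lemma fac_bound (n : ℕ) : (n+2)^(n+1) ≤ 9^(n+1) * (n+1).factorial := by
  have h := Real.pow_div_factorial_le_exp ((n:ℝ)+2) (by positivity) (n+1)
  rw [div_le_iff₀ (by positivity)] at h
  have h2 : Real.exp ((n:ℝ)+2) ≤ 9^(n+1) := by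
    have : ((n:ℝ)+2) = ((n+2 : ℕ) : ℝ) * 1 := by push_cast; ring
    rw [this, Real.exp_nat_mul]
    calc Real.exp 1 ^ (n+2) ≤ 3^(n+2) := by
          gcongr; linarith [Real.exp_one_lt_d9]
      _ ≤ 3^(2*(n+1)) := by gcongr; norm_num; omega
      _ = 9^(n+1) := by rw [pow_mul]; norm_num
  have h3 : ((n:ℝ)+2)^(n+1) ≤ 9^(n+1) * ((n+1).factorial : ℝ) := h.trans (by gcongr)
  exact_mod_cast h3

lemma coeffX (N ν : ℕ) : ((X - 1 : ℤ[X])^N).coeff ν = (-1)^(N-ν) * (N.choose ν : ℤ) := by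
  have : (X - 1 : ℤ[X]) = X + C (-1) := by simp [sub_eq_add_neg]
  rw [this, coeff_X_add_C_pow]

lemma pade_one (q s n k : ℕ) (hs : s < q) (hk : k ≤ s) : ∃ g : ℤ[X],
    (X - 1 : ℤ[X])^((s+1)*(n+1)) ∣ g ∧
    (∀ ν, s < ν % q → g.coeff ν = 0) ∧
    (∀ ν, q*(n+2) ≤ ν → g.coeff ν = 0) ∧
    (∀ j, j < q → j ≠ k → g.coeff (j + q*(n+1)) = 0) ∧
    g.coeff (k + q*(n+1)) ≠ 0 ∧
    (∀ ν, |g.coeff ν| ≤ (((9*q^2)^q*(2*q)^s*4^q : ℕ) : ℤ)^(n+1)) := by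
  set N := k + q*(n+1) with hN
  obtain ⟨r, hr⟩ : ∃ r, q = s + 1 + r := ⟨q - s - 1, by omega⟩
  -- step 1
  obtain ⟨g1, hg1, hc1⟩ := op_fin (Finset.range k) (fun j => ((j + q*(n+1) : ℕ) : ℤ))
    ((s+1)*(n+1) + ((Finset.Ico (s+1) q) ×ˢ (Finset.range (n+1))).card) ((X-1)^N)
    (by
      apply pow_dvd_pow
      rw [Finset.card_product, Nat.card_Ico, Finset.card_range, Finset.card_range]
      have : q - (s+1) = r := by omega
      rw [this, hN, hr]
      apply le_of_eq; ring)
  obtain ⟨g0, hg0, hc0⟩ := op_fin ((Finset.Ico (s+1) q) ×ˢ (Finset.range (n+1)))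
    (fun x => ((x.1 + q * x.2 : ℕ) : ℤ)) ((s+1)*(n+1)) g1 hg1
  have hcoef : ∀ ν : ℕ, g0.coeff ν =
      (∏ j ∈ Finset.Ico (s+1) q, ∏ h ∈ Finset.range (n+1), ((ν:ℤ) - j - q * h)) *
      ((∏ j ∈ Finset.range k, ((ν:ℤ) - j - q*(n+1))) * ((-1)^(N-ν) * (N.choose ν : ℤ))) := by
    intro ν
    rw [hc0, hc1, coeffX, Finset.prod_product]
    congr 1
    · apply Finset.prod_congr rfl; intro j _
      apply Finset.prod_congr rfl; intro h _
      push_cast; ring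
    · congr 1
      apply Finset.prod_congr rfl; intro j _
      push_cast; ring
  have hcard : (Finset.Ico (s+1) q).card = r := by rw [Nat.card_Ico]; omega
  have hdiv : C ((((n+1).factorial : ℕ) : ℤ)^r) ∣ C (((q:ℤ)^(n+1))^r) * g0 := by
    rw [C_dvd_iff_dvd_coeff]
    intro ν
    rw [coeff_C_mul, hcoef, ← mul_assoc]
    apply Dvd.dvd.mul_right
    rw [← hcard, ← Finset.prod_const, ← Finset.prod_const, ← Finset.prod_mul_distrib]
    apply Finset.prod_dvd_prod_of_dvd
    intro j _
    exact ap_dvd q (n+1) _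
  obtain ⟨g, hg⟩ := hdiv
  have hL : ((((n+1).factorial : ℕ) : ℤ)^r) ≠ 0 := by positivity
  have hq : 0 < q := by omega
  have hgc : ∀ ν, ((((n+1).factorial : ℕ) : ℤ)^r) * g.coeff ν = ((q:ℤ)^(n+1))^r * g0.coeff ν := by
    intro ν
    rw [← coeff_C_mul, ← coeff_C_mul, hg]
  have hz : ∀ ν, g0.coeff ν = 0 → g.coeff ν = 0 := by
    intro ν h
    have := hgc ν
    rw [h, mul_zero] at this
    exact (mul_eq_zero.1 this).resolve_left hL
  have hbig : ∀ ν, N < ν → g0.coeff ν = 0 := by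
    intro ν h; rw [hcoef, Nat.choose_eq_zero_of_lt h]; simp
  have hbigN : N < q*(n+2) := by rw [hN]; nlinarith
  refine ⟨g, ?_, ?_, ?_, ?_, ?_, ?_⟩
  · have hm : (X - 1 : ℤ[X]).Monic := by simpa using monic_X_sub_C (1:ℤ)
    have hm2 := hm.pow ((s+1)*(n+1))
    rw [← modByMonic_eq_zero_iff_dvd hm2]
    have h1 : (C ((((n+1).factorial : ℕ) : ℤ)^r) * g) %ₘ (X - 1 : ℤ[X])^((s+1)*(n+1)) = 0 := by
      rw [modByMonic_eq_zero_iff_dvd hm2, ← hg]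
      exact Dvd.dvd.mul_left hg0 _
    rw [← smul_eq_C_mul, smul_modByMonic] at h1
    exact (smul_eq_zero.1 h1).resolve_left hL
  · intro ν h
    apply hz
    by_cases hb : N < ν
    · exact hbig ν hb
    rw [hcoef]
    have : (∏ j ∈ Finset.Ico (s+1) q, ∏ h ∈ Finset.range (n+1), ((ν:ℤ) - j - q * h)) = 0 := by
      apply Finset.prod_eq_zero (i := ν % q)
      · simp only [Finset.mem_Ico]; exact ⟨h, Nat.mod_lt _ hq⟩
      · have hd := Nat.mod_add_div ν q
        apply Finset.prod_eq_zero (i := ν / q)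
        · rw [Finset.mem_range]
          by_contra hcon
          push Not at hcon
          have : q * (n+1) ≤ q * (ν/q) := Nat.mul_le_mul_left _ hcon
          omega
        · have : (ν:ℤ) = ((ν % q : ℕ):ℤ) + (q:ℤ) * ((ν/q : ℕ):ℤ) := by exact_mod_cast hd.symm
          linarith
    rw [this, zero_mul]
  · intro ν h
    exact hz _ (hbig _ (by omega))
  · intro j hj hjk
    apply hz
    rcases lt_or_gt_of_ne hjk with h | h
    · rw [hcoef]
      have : (∏ i ∈ Finset.range k, (((j + q*(n+1) : ℕ):ℤ) - i - q*(n+1))) = 0 := by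
        apply Finset.prod_eq_zero (i := j)
        · simpa using h
        · push_cast; ring
      rw [this]; simp
    · apply hbig; omega
  · intro h
    have h2 := hgc N
    rw [h, mul_zero, hcoef] at h2
    have h3 : ((q:ℤ)^(n+1))^r ≠ 0 := by positivity
    have h4 := (mul_eq_zero.1 h2.symm).resolve_left h3
    rcases mul_eq_zero.1 h4 with h5 | h5
    · rw [Finset.prod_eq_zero_iff] at h5
      obtain ⟨j, hj, h6⟩ := h5
      rw [Finset.prod_eq_zero_iff] at h6
      obtain ⟨h, hh, h7⟩ := h6
      rw [Finset.mem_Ico] at hj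
      rw [Finset.mem_range] at hh
      have h8 : (N:ℤ) = j + q*h := by linarith
      have h9 : N = j + q*h := by exact_mod_cast h8
      have : N % q = j % q := by rw [h9]; simp
      rw [hN] at this
      simp at this
      rw [Nat.mod_eq_of_lt (by omega), Nat.mod_eq_of_lt (by omega)] at this
      omega
    · rcases mul_eq_zero.1 h5 with h6 | h6
      · rw [Finset.prod_eq_zero_iff] at h6
        obtain ⟨j, hj, h7⟩ := h6
        rw [Finset.mem_range] at hj
        rw [hN] at h7; push_cast at h7
        have : (k:ℤ) = j := by linarith
        have : k = j := by exact_mod_cast this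
        omega
      · simp at h6
  · intro ν
    by_cases hb : N < ν
    · rw [hz _ (hbig _ hb), abs_zero]; positivity
    have hνN : ν ≤ q*(n+2) := by omega
    have habs : ∀ j h : ℕ, j < q → h ≤ n + 1 → |(ν:ℤ) - j - q*h| ≤ ((q*(n+2) : ℕ):ℤ) := by
      intro j h hj hh
      have h1 : j + q*h ≤ q*(n+2) := by nlinarith
      have h2 : (j:ℤ) + q*h ≤ ((q*(n+2) : ℕ):ℤ) := by exact_mod_cast h1
      have h3 : (ν:ℤ) ≤ ((q*(n+2) : ℕ):ℤ) := by exact_mod_cast hνN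
      rw [abs_le]; constructor
      · linarith [Int.natCast_nonneg ν]
      · have : 0 ≤ (j:ℤ) + q*h := by positivity
        linarith
    have hF : (0:ℤ) < (((n+1).factorial : ℕ) : ℤ)^r := by positivity
    have key : ((((n+1).factorial : ℕ) : ℤ)^r) * |g.coeff ν| ≤
        ((((n+1).factorial : ℕ) : ℤ)^r) * (((9*q^2)^q*(2*q)^s*4^q : ℕ) : ℤ)^(n+1) := by
      have e1 : ((((n+1).factorial : ℕ) : ℤ)^r) * |g.coeff ν| = |((((n+1).factorial : ℕ) : ℤ)^r) * g.coeff ν| := by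
        rw [abs_mul, abs_of_pos hF]
      rw [e1, hgc, hcoef, abs_mul, abs_mul, abs_mul, Finset.abs_prod, Finset.abs_prod, abs_mul]
      have b1 : |((q:ℤ)^(n+1))^r| = ((q:ℤ)^(n+1))^r := abs_of_nonneg (by positivity)
      have b2 : ∏ j ∈ Finset.Ico (s+1) q, |∏ h ∈ Finset.range (n+1), ((ν:ℤ) - j - q * h)| ≤
          (((q*(n+2) : ℕ):ℤ)^(n+1))^r := by
        rw [← hcard, ← Finset.prod_const]
        apply Finset.prod_le_prod (fun _ _ => abs_nonneg _)
        intro j hj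
        rw [Finset.mem_Ico] at hj
        rw [Finset.abs_prod]
        calc _ ≤ ∏ h ∈ Finset.range (n+1), ((q*(n+2) : ℕ):ℤ) := by
              apply Finset.prod_le_prod (fun _ _ => abs_nonneg _)
              intro h hh
              rw [Finset.mem_range] at hh
              exact habs j h hj.2 (by omega)
          _ = _ := by rw [Finset.prod_const, Finset.card_range]
      have b3 : ∏ j ∈ Finset.range k, |(ν:ℤ) - j - q*(n+1)| ≤ ((q*(n+2) : ℕ):ℤ)^k := by
        calc _ ≤ ∏ h ∈ Finset.range k, ((q*(n+2) : ℕ):ℤ) := by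
              apply Finset.prod_le_prod (fun _ _ => abs_nonneg _)
              intro j hj
              rw [Finset.mem_range] at hj
              have := habs j (n+1) (by omega) le_rfl
              push_cast at this ⊢
              exact this
          _ = _ := by rw [Finset.prod_const, Finset.card_range]
      have b4 : |(-1:ℤ)^(N-ν)| * |(N.choose ν : ℤ)| ≤ 2^(q*(n+2)) := by
        rw [abs_pow]
        simp only [abs_neg, abs_one, one_pow, one_mul, Nat.abs_cast]
        have : N.choose ν ≤ 2^(q*(n+2)) := (Nat.choose_le_two_pow _ _).trans (Nat.pow_le_pow_right (by norm_num) hbigN.le)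
        exact_mod_cast this
      rw [b1]
      calc _ ≤ ((q:ℤ)^(n+1))^r * ((((q*(n+2) : ℕ):ℤ)^(n+1))^r * (((q*(n+2) : ℕ):ℤ)^k * 2^(q*(n+2)))) := by
            gcongr
        _ ≤ _ := by
            norm_cast
            have c1 := fac_bound n
            have c2 : n + 2 ≤ 2^(n+1) := by
              have := Nat.lt_two_pow_self (n := n+1); omega
            have c3 : (q*(n+2))^k ≤ ((2*q)^s)^(n+1) := by
              calc (q*(n+2))^k ≤ (q*(n+2))^s := Nat.pow_le_pow_right (by positivity) hk
                _ ≤ (q^(n+1) * 2^(n+1))^s := by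
                  gcongr; exact Nat.le_self_pow (by omega) q
                _ = _ := by rw [← mul_pow, ← pow_mul, ← pow_mul, mul_comm q 2]; congr 1; ring
            have c4 : 2^(q*(n+2)) ≤ (4^q)^(n+1) := by
              calc 2^(q*(n+2)) ≤ 2^(2*(q*(n+1))) := Nat.pow_le_pow_right (by norm_num) (by nlinarith)
                _ = _ := by rw [pow_mul, pow_mul]; norm_num
            have c5 : (q^(n+1))^r * ((q*(n+2))^(n+1))^r ≤ ((n+1).factorial)^r * ((9*q^2)^q)^(n+1) := by
              calc (q^(n+1))^r * ((q*(n+2))^(n+1))^r = (q^(n+1)* q^(n+1) * (n+2)^(n+1))^r := by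
                    rw [← mul_pow, mul_pow q (n+2)]; ring
                _ ≤ (q^(n+1)* q^(n+1) * (9^(n+1) * (n+1).factorial))^r := by gcongr
                _ = ((n+1).factorial)^r * ((9*q^2)^r)^(n+1) := by
                    rw [← pow_mul, mul_comm r (n+1), pow_mul, ← mul_pow]; congr 1
                    rw [mul_pow 9]; ring
                _ ≤ _ := by
                    gcongr
                    · nlinarith
                    · omega
            calc _ = ((q^(n+1))^r * ((q*(n+2))^(n+1))^r) * ((q*(n+2))^k * 2^(q*(n+2))) := by ring
              _ ≤ (((n+1).factorial)^r * ((9*q^2)^q)^(n+1)) * (((2*q)^s)^(n+1) * (4^q)^(n+1)) := by gcongr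
              _ = _ := by rw [mul_pow, mul_pow]; ring
    exact le_of_mul_le_mul_left key hF

lemma sum_range_mul' {M : Type*} [AddCommMonoid M] (f : ℕ → M) (q m : ℕ) :
    ∑ ν ∈ Finset.range (q*m), f ν = ∑ h ∈ Finset.range m, ∑ j ∈ Finset.range q, f (j + q*h) := by
  induction m with
  | zero => simp
  | succ m ih =>
    rw [Nat.mul_succ, Finset.sum_range_add, ih, Finset.sum_range_succ]
    congr 1
    apply Finset.sum_congr rfl
    intro j _
    rw [add_comm]

lemma pade (q s n : ℕ) (hs : s < q) : ∃ (Q : Fin (s+1) → Fin (s+1) → ℤ[X]) (g : Fin (s+1) → ℤ[X]),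
    (∀ k j, (Q k j).natDegree ≤ n+1) ∧
    (∀ k j i, |(Q k j).coeff i| ≤ (((9*q^2)^q*(2*q)^s*4^q : ℕ) : ℤ)^(n+1)) ∧
    (∀ k i, |(g k).coeff i| ≤ (((9*q^2)^q*(2*q)^s*4^q : ℕ) : ℤ)^(n+1)) ∧
    (∀ k, (g k).natDegree < q*(n+2)) ∧
    (∀ k, ∑ j : Fin (s+1), X^(j:ℕ) * expand ℤ q (Q k j) = g k) ∧
    (∀ k, (X - 1 : ℤ[X])^((s+1)*(n+1)) ∣ g k) ∧
    (∀ k j, j ≠ k → (Q k j).coeff (n+1) = 0) ∧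
    (∀ k, (Q k k).coeff (n+1) ≠ 0) := by
  have := fun k : Fin (s+1) => pade_one q s n k hs (by omega)
  choose g h1 h2 h3 h4 h5 h6 using this
  have hq : 0 < q := by omega
  have hc : ∀ (k j : Fin (s+1)) i, (∑ h ∈ Finset.range (n+2), C ((g k).coeff (j + q*h)) * X^h : ℤ[X]).coeff i
      = if i < n + 2 then (g k).coeff (j + q*i) else 0 := by
    intro k j i
    simp [coeff_X_pow]
  have hdg : ∀ k, (g k).natDegree < q*(n+2) := by
    intro k
    by_contra hcon
    push Not at hcon
    have := h3 k _ hcon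
    rw [coeff_natDegree, leadingCoeff_eq_zero] at this
    rw [this, natDegree_zero] at hcon
    have : 0 < q * (n+2) := by positivity
    omega
  refine ⟨fun k j => ∑ h ∈ Finset.range (n+2), C ((g k).coeff (j + q*h)) * X^h, g, ?_, ?_, h6, hdg, ?_, h1, ?_, ?_⟩
  · intro k j
    rw [natDegree_le_iff_coeff_eq_zero]
    intro i hi
    rw [hc, if_neg (by omega)]
  · intro k j i
    rw [hc]
    split_ifs
    · exact h6 _ _
    · rw [abs_zero]; positivity
  · intro k
    conv_rhs => rw [as_sum_range' (g k) _ (hdg k), sum_range_mul']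
    have : ∀ h ∈ Finset.range (n+2), ∑ j ∈ Finset.range q, (monomial (j + q*h)) ((g k).coeff (j + q*h)) =
        ∑ j ∈ Finset.range (s+1), (monomial (j + q*h)) ((g k).coeff (j + q*h)) := by
      intro h _
      symm
      apply Finset.sum_subset
      · intro j; simp; omega
      · intro j hj hj2
        simp at hj hj2
        rw [h2 k _ _, monomial_zero_right]
        simp [Nat.mod_eq_of_lt hj]; omega
    rw [Finset.sum_congr rfl this, Finset.sum_comm,
      ← Fin.sum_univ_eq_sum_range (fun j => ∑ h ∈ Finset.range (n+2), (monomial (j + q*h)) ((g k).coeff (j + q*h)))]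
    apply Finset.sum_congr rfl
    intro j _
    rw [map_sum, Finset.mul_sum]
    apply Finset.sum_congr rfl
    intro h _
    simp [← C_mul_X_pow_eq_monomial]
    ring
  · intro k j hjk
    rw [hc, if_pos (by omega)]
    exact h4 k j (by omega) (fun h => hjk (Fin.ext h))
  · intro k
    rw [hc, if_pos (by omega)]
    exact h5 k

lemma det_ne (q s t : ℕ) (hq : 0 < q) (Q : Fin (s+1) → Fin (s+1) → ℤ[X])
    (hd : ∀ k j, (Q k j).natDegree ≤ t)
    (hv : ∀ k, (X - 1 : ℤ[X])^((s+1)*t) ∣ ∑ j : Fin (s+1), X^(j:ℕ) * expand ℤ q (Q k j))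
    (h0 : ∀ k j, j ≠ k → (Q k j).coeff t = 0) (h1 : ∀ k, (Q k k).coeff t ≠ 0)
    {F : Type*} [Field F] [CharZero F] (y : F) (hy : y ≠ 1) :
    (Matrix.of (fun k j => aeval y (Q k j))).det ≠ 0 := by
  set P : ℤ[X] := (Matrix.of Q).det with hP
  set L := (s+1)*t with hL
  have hPd : P.natDegree ≤ L := by
    rw [hP, Matrix.det_apply]
    apply natDegree_sum_le_of_forall_le
    intro σ _
    refine (natDegree_smul_le _ _).trans ?_
    refine (natDegree_prod_le _ _).trans ?_
    refine (Finset.sum_le_card_nsmul _ _ t (fun i _ => hd _ _)).trans ?_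
    simp [hL]
  have hPc : P.coeff L ≠ 0 := by
    have : P.coeff L = (Matrix.of (fun k j => (Q k j).coeff t)).det := by
      rw [hP, Matrix.det_apply, Matrix.det_apply, finsetSum_coeff]
      apply Finset.sum_congr rfl
      intro σ _
      rw [coeff_smul]
      congr 1
      have := coeff_prod_of_natDegree_le Finset.univ (fun i => Matrix.of Q (σ i) i) t (fun i _ => hd _ _)
      simp only [Finset.card_univ, Fintype.card_fin] at this
      rw [hL, this]; rfl
    rw [this]
    have hdiag : Matrix.of (fun k j => (Q k j).coeff t) = Matrix.diagonal (fun k => (Q k k).coeff t) := by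
      ext k j
      by_cases h : j = k
      · subst h; simp
      · rw [Matrix.diagonal_apply_ne _ (Ne.symm h)]; exact h0 k j h
    rw [hdiag, Matrix.det_diagonal]
    exact Finset.prod_ne_zero_iff.2 (fun k _ => h1 k)
  have hdvd : (X - 1 : ℤ[X])^L ∣ (∏ j : Fin (s+1), X^(j:ℕ)) * expand ℤ q P := by
    set M' : Matrix (Fin (s+1)) (Fin (s+1)) ℤ[X] := Matrix.of (fun k j => X^(j:ℕ) * expand ℤ q (Q k j)) with hM'
    have hdet : M'.det = (∏ j : Fin (s+1), X^(j:ℕ)) * expand ℤ q P := by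
      rw [hM', hP, AlgHom.map_det, ← Matrix.det_mul_row]
      rfl
    rw [← hdet]
    have e1 : M'.adjugate.mulVec (M'.mulVec (fun _ => 1)) 0 = M'.det := by
      rw [Matrix.mulVec_mulVec, Matrix.adjugate_mul]
      simp [Matrix.smul_mulVec]
    rw [← e1, Matrix.mulVec, dotProduct]
    apply Finset.dvd_sum
    intro k _
    apply Dvd.dvd.mul_left
    have : M'.mulVec (fun _ => 1) k = ∑ j : Fin (s+1), X^(j:ℕ) * expand ℤ q (Q k j) := by
      simp [Matrix.mulVec, dotProduct, hM']
    rw [this]; exact hv k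
  set PF : F[X] := P.map (Int.castRingHom F) with hPF
  have hPFc : PF.coeff L ≠ 0 := by rw [hPF, coeff_map]; simpa using hPc
  have hPF0 : PF ≠ 0 := by intro h; rw [h] at hPFc; simp at hPFc
  have hPFd : PF.natDegree ≤ L := natDegree_map_le.trans hPd
  have hdvdF : (X - 1 : F[X])^L ∣ (∏ j : Fin (s+1), X^(j:ℕ)) * expand F q PF := by
    have := map_dvd (mapRingHom (Int.castRingHom F)) hdvd
    simp only [map_pow, map_sub, map_mul, map_prod, coe_mapRingHom, map_X, Polynomial.map_one, map_expand] at this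
    exact this
  obtain ⟨R, hR, hR1⟩ := exists_eq_pow_rootMultiplicity_mul_and_not_dvd PF hPF0 1
  set e := rootMultiplicity 1 PF with he
  have hR1' : R.eval 1 ≠ 0 := by
    intro h; exact hR1 (dvd_iff_isRoot.2 h)
  have heL : L ≤ e := by
    by_contra hcon
    push Not at hcon
    obtain ⟨f, hf⟩ : ∃ f, L = e + (f+1) := ⟨L - e - 1, by omega⟩
    have hgeom : (X^q - 1 : F[X]) = (X - 1) * ∑ i ∈ Finset.range q, X^i := (mul_geom_sum X q).symm
    have : expand F q PF = (X-1)^e * ((∑ i ∈ Finset.range q, X^i)^e * expand F q R) := by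
      conv_lhs => rw [hR]
      simp only [map_mul, map_pow, map_sub, expand_X, expand_C]
      rw [C_1, hgeom, mul_pow, mul_assoc]
    rw [this, hf, pow_add, mul_left_comm] at hdvdF
    have hX : (X - 1 : F[X])^e ≠ 0 := pow_ne_zero _ (by simpa using X_sub_C_ne_zero (1:F))
    have h2 := (mul_dvd_mul_iff_left hX).1 hdvdF
    obtain ⟨T, hT⟩ := (dvd_trans (dvd_pow_self (X-1:F[X]) (Nat.succ_ne_zero f)) h2)
    have h3 := congrArg (eval 1) hT
    simp [eval_prod, eval_finsetSum] at h3
    rcases h3 with h3 | h3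
    · exact hq.ne' h3.1
    · exact hR1' h3
  have hdeg : PF.natDegree = e + R.natDegree := by
    have hR0 : R ≠ 0 := by rintro rfl; simp at hR1'
    conv_lhs => rw [hR]
    rw [natDegree_mul (pow_ne_zero _ (X_sub_C_ne_zero _)) hR0, natDegree_pow, natDegree_X_sub_C, mul_one]
  have hRd : R.natDegree = 0 := by omega
  obtain ⟨r, hr⟩ := natDegree_eq_zero.1 hRd
  have hfin : (Matrix.of (fun k j => aeval y (Q k j))).det = PF.eval y := by
    have := (aeval y : ℤ[X] →ₐ[ℤ] F).map_det (Matrix.of Q)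
    rw [← hP] at this
    rw [hPF, eval_map]
    have h2 : eval₂ (Int.castRingHom F) y P = aeval y P := rfl
    rw [h2, this]
    rfl
  rw [hfin, hR, eval_mul, ← hr]
  rw [← hr] at hR1'
  simp at hR1' ⊢
  exact ⟨fun h => absurd (sub_eq_zero.1 h) hy, hR1'⟩


lemma norm_aeval_le (g : ℤ[X]) (M : ℕ) (B R : ℝ) (hd : g.natDegree < M) (hB : ∀ i, |((g.coeff i : ℤ) : ℝ)| ≤ B)
    (hR : 1 ≤ R) (w : ℂ) (hw : ‖w‖ ≤ R) : ‖aeval w g‖ ≤ M * (B * R^M) := by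
  have hB0 : 0 ≤ B := (abs_nonneg _).trans (hB 0)
  rw [aeval_eq_sum_range' hd]
  refine (norm_sum_le _ _).trans ?_
  calc _ ≤ ∑ i ∈ Finset.range M, B * R^M := by
        apply Finset.sum_le_sum
        intro i hi
        rw [Finset.mem_range] at hi
        rw [zsmul_eq_mul, norm_mul, norm_pow, Complex.norm_intCast]
        have : ‖w‖^i ≤ R^M := (pow_le_pow_left₀ (norm_nonneg _) hw i).trans (pow_le_pow_right₀ hR hi.le)
        gcongr
        exact hB i
    _ = _ := by simp

lemma norm_aeval_near (g : ℤ[X]) (M L : ℕ) (B : ℝ) (hd : g.natDegree < M) (hB : ∀ i, |((g.coeff i : ℤ) : ℝ)| ≤ B)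
    (hL : (X - 1 : ℤ[X])^L ∣ g) (u : ℂ) (hu : ‖u - 1‖ ≤ 1) :
    ‖aeval u g‖ ≤ ‖u-1‖^L * (M * (M * (B * 2^M))) := by
  have hB0 : 0 ≤ B := (abs_nonneg _).trans (hB 0)
  set h := g.comp (X + 1) with hh
  have e1 : aeval u g = aeval (u-1) h := by
    rw [hh, aeval_comp]; simp
  have hXL : X^L ∣ h := by
    obtain ⟨r, rfl⟩ := hL
    rw [hh, mul_comp, pow_comp]
    simp
  have hz : ∀ i, i < L → h.coeff i = 0 := X_pow_dvd_iff.1 hXL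
  have hdh : h.natDegree < M := by
    have : (X + 1 : ℤ[X]).natDegree = 1 := by simpa using natDegree_X_add_C (1:ℤ)
    rw [hh, natDegree_comp, this]; omega
  have hc : ∀ i, |((h.coeff i : ℤ):ℝ)| ≤ M * (B * 2^M) := by
    intro i
    have : h = ∑ ν ∈ Finset.range M, C (g.coeff ν) * (X+1)^ν := by
      conv_lhs => rw [hh, as_sum_range_C_mul_X_pow' g hd]
      simp [Polynomial.sum_comp]
    rw [this, finsetSum_coeff]
    push_cast
    refine (Finset.abs_sum_le_sum_abs _ _).trans ?_
    calc _ ≤ ∑ ν ∈ Finset.range M, B * 2^M := by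
          apply Finset.sum_le_sum
          intro ν hν
          rw [Finset.mem_range] at hν
          rw [coeff_C_mul, coeff_X_add_one_pow]
          push_cast
          rw [abs_mul, Nat.abs_cast]
          have : (ν.choose i : ℝ) ≤ 2^M := by
            exact_mod_cast (Nat.choose_le_two_pow ν i).trans (Nat.pow_le_pow_right (by norm_num) hν.le)
          gcongr
          exact hB ν
      _ = _ := by simp
  rw [e1, aeval_eq_sum_range' hdh]
  refine (norm_sum_le _ _).trans ?_
  calc _ ≤ ∑ i ∈ Finset.range M, ‖u-1‖^L * (M * (B * 2^M)) := by
        apply Finset.sum_le_sum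
        intro i hi
        rw [zsmul_eq_mul, norm_mul, norm_pow, Complex.norm_intCast]
        by_cases hiL : i < L
        · rw [hz i hiL]; simp; positivity
        · rw [mul_comm]
          have : ‖u-1‖^i ≤ ‖u-1‖^L := pow_le_pow_of_le_one (norm_nonneg _) hu (by omega)
          gcongr
          exact hc i
    _ = _ := by simp; ring

lemma liouville_lower {K : Type*} [Field K] [NumberField K] (φ0 : K →+* ℂ) (x : K) (hx : IsIntegral ℤ x)
    (hx0 : x ≠ 0) (B : ℝ) (hB : 1 ≤ B) (h : ∀ φ : K →+* ℂ, ‖φ x‖ ≤ B) :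
    1 ≤ B^(Module.finrank ℚ K) * ‖φ0 x‖ := by
  classical
  have hint : IsIntegral ℤ (Algebra.norm ℚ x) := Algebra.isIntegral_norm ℚ hx
  obtain ⟨z, hz⟩ := IsIntegrallyClosed.isIntegral_iff.1 hint
  have hz0 : z ≠ 0 := by
    rintro rfl
    simp at hz
    exact hx0 (Algebra.norm_eq_zero_iff.1 hz.symm)
  have hN := Algebra.norm_eq_prod_embeddings ℚ ℂ x
  have h1 : (1:ℝ) ≤ ‖(algebraMap ℚ ℂ) (Algebra.norm ℚ x)‖ := by
    rw [← hz]
    simp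
    exact_mod_cast Int.one_le_abs hz0
  rw [hN, norm_prod] at h1
  set φ1 : K →ₐ[ℚ] ℂ := φ0.toRatAlgHom with hφ1
  rw [← Finset.mul_prod_erase _ _ (Finset.mem_univ φ1)] at h1
  have h2 : ∏ σ ∈ Finset.univ.erase φ1, ‖σ x‖ ≤ B^(Module.finrank ℚ K) := by
    calc _ ≤ ∏ σ ∈ Finset.univ.erase φ1, B :=
          Finset.prod_le_prod (fun _ _ => norm_nonneg _) (fun σ _ => h (σ : K →+* ℂ))
      _ = B^((Finset.univ.erase φ1).card) := by rw [Finset.prod_const]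
      _ ≤ _ := by
          apply pow_le_pow_right₀ hB
          refine (Finset.card_erase_le).trans ?_
          rw [Finset.card_univ, AlgHom.card ℚ K ℂ]
  have h3 : ‖φ1 x‖ = ‖φ0 x‖ := rfl
  rw [h3] at h1
  calc (1:ℝ) ≤ _ := h1
    _ ≤ ‖φ0 x‖ * B^(Module.finrank ℚ K) := by gcongr
    _ = _ := mul_comm _ _

lemma pow_sub_one_norm (u : ℂ) (hu : ‖u - 1‖ ≤ 1) (s i : ℕ) (hi : i ≤ s) :
    ‖u^i - 1‖ ≤ ‖u-1‖ * (s * 2^s) := by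
  have hu2 : ‖u‖ ≤ 2 := by
    have := norm_add_le (u-1) 1
    simp at this; linarith
  rw [← mul_geom_sum u i, norm_mul]
  gcongr
  refine (norm_sum_le _ _).trans ?_
  calc _ ≤ ∑ l ∈ Finset.range i, (2:ℝ)^s := by
        apply Finset.sum_le_sum
        intro l hl
        rw [Finset.mem_range] at hl
        rw [norm_pow]
        exact (pow_le_pow_left₀ (norm_nonneg _) hu2 l).trans (pow_le_pow_right₀ (by norm_num) (by omega))
    _ = i * 2^s := by simp
    _ ≤ _ := by gcongr

lemma exists_root (q : ℕ) (hq : 0 < q) (w : ℂ) (hw : ‖w - 1‖ ≤ 1/2) :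
    ∃ u : ℂ, u^q = w ∧ ‖u - 1‖ ≤ 3 * ‖w-1‖ := by
  have h0 : w ≠ 0 := by rintro rfl; norm_num at hw
  refine ⟨Complex.exp (Complex.log w / q), ?_, ?_⟩
  · rw [← Complex.exp_nat_mul, mul_div_cancel₀ _ (by exact_mod_cast hq.ne'), Complex.exp_log h0]
  · have h1 := Complex.norm_log_one_add_half_le_self hw
    rw [add_sub_cancel] at h1
    have h2 : ‖Complex.log w / q‖ ≤ 3/2 * ‖w-1‖ := by
      rw [norm_div, Complex.norm_natCast]
      exact (div_le_self (norm_nonneg _) (by exact_mod_cast hq)).trans h1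
    have h3 := Complex.norm_exp_sub_one_le (x := Complex.log w / q) (by linarith)
    linarith


lemma core_aux (n : ℕ) (T A1 A2 A3 : ℝ) (hT : 0 ≤ T) (h1 : 0 ≤ A1) (h2 : 0 ≤ A2) (h3 : 0 ≤ A3)
    (h : A2 = 0 ∨ 1 ≤ A2) : T * A1^(n+1) ≤ ((T+1)*(A1+A2*A3)+1)^(n+1) ∧
      T * (A2*A3^(n+1)) ≤ ((T+1)*(A1+A2*A3)+1)^(n+1) := by
  have hT1 : T ≤ (T+1)^(n+1) := by
    calc T ≤ T + 1 := by linarith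
      _ ≤ _ := le_self_pow₀ (by linarith) (by omega)
  have hA : A2 ≤ A2^(n+1) := by
    rcases h with h | h
    · rw [h]; simp
    · exact le_self_pow₀ h (by omega)
  constructor
  · calc T * A1^(n+1) ≤ (T+1)^(n+1) * A1^(n+1) := by gcongr
      _ = ((T+1)*A1)^(n+1) := by rw [mul_pow]
      _ ≤ _ := by
          gcongr
          have : 0 ≤ (T+1) * (A2*A3) := by positivity
          linarith
  · calc T * (A2 * A3^(n+1)) ≤ (T+1)^(n+1) * (A2^(n+1) * A3^(n+1)) := by gcongr
      _ = ((T+1)*(A2*A3))^(n+1) := by rw [mul_pow, mul_pow]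
      _ ≤ _ := by
          gcongr
          have : 0 ≤ (T+1) * A1 := by positivity
          linarith

set_option maxHeartbeats 1000000 in
lemma core {K : Type*} [Field K] [NumberField K] (φ0 : K →+* ℂ) (q s : ℕ) (hs : s < q) (b d : ℕ)
    (hb : 1 ≤ b) (hd : 1 ≤ d) (β : K) (θ : ℂ)
    (hβi : IsIntegral ℤ ((b:K) * β)) (hβ : ∀ φ : K →+* ℂ, ‖φ β‖ ≤ b) :
    ∃ c : ℝ, 1 ≤ c ∧ ∀ (n M1 M2 : ℕ) (γ1 γ2 : K) (u1 u2 : ℂ),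
      IsIntegral ℤ ((d:K)^M1 * γ1) → IsIntegral ℤ ((d:K)^M2 * γ2) →
      (∀ φ : K →+* ℂ, ‖φ γ1‖ ≤ (d:ℝ)^M1) → (∀ φ : K →+* ℂ, ‖φ γ2‖ ≤ (d:ℝ)^M2) →
      γ1 ≠ 0 → φ0 γ1 = θ * u1 → φ0 γ2 = θ * u2 → u1^q = φ0 (β * γ1^q) →
      β * γ1^q ≠ 1 → ‖u1 - 1‖ ≤ 1 → ‖u2 - 1‖ ≤ 1 →
      1 ≤ c^(n+1) * (d:ℝ)^(2*(Module.finrank ℚ K+1)*(s*(M1+M2) + q*M1*(n+1))) *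
        (‖u1-1‖^((s+1)*(n+1)) + ‖u2-1‖) := by
  set D := Module.finrank ℚ K with hD
  set C0 : ℕ := (9*q^2)^q*(2*q)^s*4^q with hC0
  have hq : 0 < q := by omega
  have hC1 : 1 ≤ C0 := by rw [hC0]; exact Nat.succ_le_of_lt (by positivity)
  -- bound
  set c1 : ℝ := (s+1) * 2 * C0 * (b:ℝ)^2 with hc1
  set c2 : ℝ := (‖θ‖^s + 1) * ((2*q)^2 * C0 * 4^q + (s+1) * 2^s * (s*2^s) * (2 * C0 * 4^q)) with hc2
  refine ⟨(c1+1)^(D+1) * (c2+1), ?_, ?_⟩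
  · have : (1:ℝ) ≤ (c1+1)^(D+1) := one_le_pow₀ (by rw [hc1]; linarith [show (0:ℝ) ≤ (s+1) * 2 * C0 * (b:ℝ)^2 by positivity])
    have h2 : (1:ℝ) ≤ c2 + 1 := by
      have : 0 ≤ c2 := by positivity
      linarith
    nlinarith
  intro n M1 M2 γ1 γ2 u1 u2 hi1 hi2 hn1 hn2 hγ1 hu1 hu2 huq hne hs1 hs2
  obtain ⟨Q, g, hQd, hQc, hgc, hgd, hQg, hdv, h0, h1⟩ := pade q s n hs
  set w := β * γ1^q with hw
  have hdet := det_ne q s (n+1) hq Q hQd (fun k => by rw [hQg]; exact hdv k) h0 h1 w hne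
  set v : Fin (s+1) → K := fun j => γ1^(j:ℕ) * γ2^(s-(j:ℕ)) with hv
  have hv0 : v ≠ 0 := by
    intro h
    have := congrFun h (Fin.last s)
    simp [hv] at this
    exact hγ1 this.1
  obtain ⟨k, hk⟩ : ∃ k, ∑ j, aeval w (Q k j) * v j ≠ 0 := by
    by_contra hcon
    push Not at hcon
    apply hv0
    apply Matrix.eq_zero_of_mulVec_eq_zero hdet
    ext k
    exact hcon k
  set Z := ∑ j, aeval w (Q k j) * v j with hZ
  set W : ℕ := d^(s*(M1+M2)) * (b * d^(q*M1))^(n+1) with hW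
  have hW1 : 1 ≤ W := Nat.succ_le_of_lt (by positivity)
  have hdc : ((d:ℤ):K) = (d:K) := by simp
  have hni : ∀ m : ℕ, IsIntegral ℤ (m:K) := fun m => by
    simpa using isIntegral_algebraMap (R := ℤ) (A := K) (x := (m:ℤ))
  have hzi : ∀ m : ℤ, IsIntegral ℤ (m:K) := fun m => by
    simpa using isIntegral_algebraMap (R := ℤ) (A := K) (x := m)
  have hwi : IsIntegral ℤ (((b * d^(q*M1) : ℕ) : K) * w) := by
    have : (((b * d^(q*M1) : ℕ) : K) * w) = ((b:K)*β) * ((d:K)^M1 * γ1)^q := by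
      rw [hw]; push_cast; rw [mul_pow, ← pow_mul, mul_comm q M1]; ring
    rw [this]; exact hβi.mul (hi1.pow q)
  have hint : IsIntegral ℤ ((W:K) * Z) := by
    have : (W:K) * Z = ∑ j, (((b * d^(q*M1) : ℕ) : K)^(n+1) * aeval w (Q k j)) *
        (((d:K)^M1*γ1)^(j:ℕ) * ((d:K)^M2*γ2)^(s-(j:ℕ)) *
          ((d^(M1*(s-(j:ℕ))+ M2*(j:ℕ)) : ℕ):K)) := by
      rw [hZ, Finset.mul_sum]
      apply Finset.sum_congr rfl
      intro j _
      have e : s*(M1+M2) = M1*(j:ℕ) + M2*(s-(j:ℕ)) + (M1*(s-(j:ℕ))+ M2*(j:ℕ)) := by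
        obtain ⟨i, hi⟩ : ∃ i, s = (j:ℕ) + i := ⟨s - j, by omega⟩
        have : s - (j:ℕ) = i := by omega
        rw [this]; nth_rewrite 1 [hi]; ring
      rw [hW, e, hv]
      push_cast
      rw [pow_add, pow_add, mul_pow ((d:K)^M1), mul_pow ((d:K)^M2), ← pow_mul, ← pow_mul]
      ring
    rw [this]
    apply IsIntegral.sum
    intro j _
    refine IsIntegral.mul ?_ (((hi1.pow _).mul (hi2.pow _)).mul (hni _))
    rw [aeval_eq_sum_range' (Nat.lt_succ_of_le (hQd k j)), Finset.mul_sum]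
    apply IsIntegral.sum
    intro i hi
    rw [Finset.mem_range] at hi
    obtain ⟨l, hl⟩ : ∃ l, n + 1 = i + l := ⟨n+1-i, by omega⟩
    have : ((b * d^(q*M1) : ℕ) : K)^(n+1) * (Q k j).coeff i • w^i =
        ((b * d^(q*M1) : ℕ) : K)^l * (((Q k j).coeff i : ℤ):K) * (((b * d^(q*M1) : ℕ) : K) * w)^i := by
      rw [hl, zsmul_eq_mul, pow_add, mul_pow]; ring
    rw [this]
    exact (((hni _).pow l).mul (hzi _)).mul (hwi.pow i)
  have hcR : ∀ k j i, |(((Q k j).coeff i : ℤ):ℝ)| ≤ (C0:ℝ)^(n+1) := by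
    intro k j i; exact_mod_cast hQc k j i
  have hcg : ∀ k i, |(((g k).coeff i : ℤ):ℝ)| ≤ (C0:ℝ)^(n+1) := by
    intro k i; exact_mod_cast hgc k i
  have hn2p : (n:ℝ) + 2 ≤ 2^(n+1) := by
    have := Nat.lt_two_pow_self (n := n+1)
    have h : n + 2 ≤ 2^(n+1) := by omega
    exact_mod_cast h
  have hd1 : (1:ℝ) ≤ d := by exact_mod_cast hd
  have hb1 : (1:ℝ) ≤ b := by exact_mod_cast hb
  have hbound : ∀ φ : K →+* ℂ, ‖φ ((W:K) * Z)‖ ≤ (W:ℝ)^2 * ((s+1) * ((n+2) * (C0:ℝ)^(n+1))) := by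
    intro φ
    have hφw : ‖φ w‖ ≤ (b * (d:ℝ)^(q*M1)) := by
      rw [hw, map_mul, map_pow, norm_mul, norm_pow]
      calc _ ≤ (b:ℝ) * ((d:ℝ)^M1)^q := by gcongr; exact hβ φ; exact hn1 φ
        _ = _ := by rw [← pow_mul, mul_comm q M1]
    have hone : (1:ℝ) ≤ (b * (d:ℝ)^(q*M1)) := by
      have : (1:ℝ) ≤ (d:ℝ)^(q*M1) := one_le_pow₀ hd1
      nlinarith
    have hφQ : ∀ j, ‖φ (aeval w (Q k j))‖ ≤ (n+2) * (C0:ℝ)^(n+1) * (b * (d:ℝ)^(q*M1))^(n+1) := by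
      intro j
      rw [aeval_eq_sum_range' (Nat.lt_succ_of_le (hQd k j)), map_sum]
      refine (norm_sum_le _ _).trans ?_
      calc _ ≤ ∑ i ∈ Finset.range (n+1+1), (C0:ℝ)^(n+1) * (b * (d:ℝ)^(q*M1))^(n+1) := by
            apply Finset.sum_le_sum
            intro i hi
            rw [Finset.mem_range] at hi
            rw [zsmul_eq_mul, map_mul, map_intCast, map_pow, norm_mul, norm_pow, Complex.norm_intCast]
            have : ‖φ w‖^i ≤ (b * (d:ℝ)^(q*M1))^(n+1) :=
              (pow_le_pow_left₀ (norm_nonneg _) hφw i).trans (pow_le_pow_right₀ hone (by omega))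
            gcongr
            exact hcR k j i
        _ = _ := by simp; ring
    have hφv : ∀ j, ‖φ (v j)‖ ≤ (d:ℝ)^(s*(M1+M2)) := by
      intro j
      rw [hv]
      simp only [map_mul, map_pow, norm_mul, norm_pow]
      calc _ ≤ ((d:ℝ)^M1)^(j:ℕ) * ((d:ℝ)^M2)^(s-(j:ℕ)) := by gcongr; exact hn1 φ; exact hn2 φ
        _ ≤ ((d:ℝ)^M1)^s * ((d:ℝ)^M2)^s := by
            gcongr
            · exact one_le_pow₀ hd1
            · omega
            · exact one_le_pow₀ hd1
            · omega
        _ = _ := by rw [← pow_mul, ← pow_mul, ← pow_add]; congr 1; ring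
    have hWr : (W:ℝ) = (d:ℝ)^(s*(M1+M2)) * (b * (d:ℝ)^(q*M1))^(n+1) := by rw [hW]; push_cast; ring
    have hφZ : ‖φ Z‖ ≤ (W:ℝ) * ((s+1) * ((n+2) * (C0:ℝ)^(n+1))) := by
      rw [hZ, map_sum]
      refine (norm_sum_le _ _).trans ?_
      calc _ ≤ ∑ j : Fin (s+1), ((n+2) * (C0:ℝ)^(n+1) * (b * (d:ℝ)^(q*M1))^(n+1)) * (d:ℝ)^(s*(M1+M2)) := by
            apply Finset.sum_le_sum
            intro j _
            rw [map_mul, norm_mul]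
            gcongr
            · exact hφQ j
            · exact hφv j
        _ = _ := by rw [hWr]; simp; ring
    rw [map_mul, norm_mul, map_natCast, Complex.norm_natCast]
    calc _ ≤ (W:ℝ) * ((W:ℝ) * ((s+1) * ((n+2) * (C0:ℝ)^(n+1)))) := by gcongr
      _ = _ := by ring
  have hWR : (1:ℝ) ≤ W := by exact_mod_cast hW1
  set Bd : ℝ := (W:ℝ)^2 * ((s+1) * ((n+2) * (C0:ℝ)^(n+1))) with hBd
  have hC1R : (1:ℝ) ≤ (C0:ℝ)^(n+1) := one_le_pow₀ (by exact_mod_cast hC1)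
  have hin1 : (1:ℝ) ≤ ((s:ℝ)+1) * (((n:ℝ)+2) * (C0:ℝ)^(n+1)) := by
    have h1 : (1:ℝ) ≤ (s:ℝ)+1 := by linarith [show (0:ℝ) ≤ s by positivity]
    have h2 : (1:ℝ) ≤ (n:ℝ)+2 := by linarith [show (0:ℝ) ≤ n by positivity]
    exact one_le_mul_of_one_le_of_one_le h1 (one_le_mul_of_one_le_of_one_le h2 hC1R)
  have hBd1 : 1 ≤ Bd := one_le_mul_of_one_le_of_one_le (one_le_pow₀ hWR) hin1
  have hWB : (W:ℝ) ≤ Bd := by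
    rw [hBd]
    calc (W:ℝ) = W * 1 * 1 := by ring
      _ ≤ W * W * ((s+1) * ((n+2) * (C0:ℝ)^(n+1))) := by gcongr
      _ = _ := by ring
  have hWZ0 : (W:K) * Z ≠ 0 := mul_ne_zero (by exact_mod_cast (by omega : W ≠ 0)) hk
  have hL := liouville_lower φ0 _ hint hWZ0 Bd hBd1 hbound
  have hL2 : 1 ≤ Bd^(D+1) * ‖φ0 Z‖ := by
    rw [map_mul, norm_mul, map_natCast, Complex.norm_natCast] at hL
    calc (1:ℝ) ≤ _ := hL
      _ ≤ Bd^D * (Bd * ‖φ0 Z‖) := by gcongr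
      _ = _ := by ring
  -- upper bound
  have hu1n : ‖u1‖ ≤ 2 := by
    have := norm_add_le (u1-1) 1
    simp at this; linarith
  have hφw : φ0 w = u1^q := huq.symm
  have hae : ∀ j, φ0 (aeval w (Q k j)) = aeval (u1^q) (Q k j) := by
    intro j
    rw [← hφw]
    have := (map_aeval_eq_aeval_map (R := ℤ) (S := K) (T := ℤ) (U := ℂ) (φ := RingHom.id ℤ) (ψ := φ0) (by ext; simp) (Q k j) w)
    simpa using this
  have hφZ : φ0 Z = θ^s * (aeval u1 (g k) + ∑ j : Fin (s+1), u1^(j:ℕ) * (u2^(s-(j:ℕ)) - 1) * aeval (u1^q) (Q k j)) := by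
    rw [← hQg k, hZ, map_sum, map_sum, ← Finset.sum_add_distrib, Finset.mul_sum]
    apply Finset.sum_congr rfl
    intro j _
    rw [map_mul, hae, hv]
    simp only [map_mul, map_pow, hu1, hu2, aeval_X, expand_aeval]
    have : θ^s = θ^(j:ℕ) * θ^(s-(j:ℕ)) := by rw [← pow_add]; congr 1; omega
    rw [this, mul_pow, mul_pow]; ring
  have hqn : ((q*(n+2) : ℕ):ℝ) ≤ (2*q)^(n+1) := by
    push_cast
    have : (q:ℝ) ≤ q^(n+1) := le_self_pow₀ (by exact_mod_cast hq) (by omega)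
    rw [mul_pow, mul_comm]
    gcongr
  have h4q : (2:ℝ)^(q*(n+2)) ≤ (4^q)^(n+1) := by
    calc (2:ℝ)^(q*(n+2)) ≤ 2^(2*(q*(n+1))) := pow_le_pow_right₀ (by norm_num) (by nlinarith)
      _ = _ := by rw [pow_mul, pow_mul]; norm_num
  have hga := norm_aeval_near (g k) (q*(n+2)) _ _ (hgd k) (hcg k) (hdv k) u1 hs1
  have hga2 : ‖aeval u1 (g k)‖ ≤ ‖u1-1‖^((s+1)*(n+1)) * ((2*q)^2 * C0 * 4^q)^(n+1) := by
    refine hga.trans ?_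
    gcongr
    calc _ ≤ ((2*q:ℝ))^(n+1) * ((2*q)^(n+1) * ((C0:ℝ)^(n+1) * (4^q)^(n+1))) := by gcongr
      _ = _ := by
        generalize (2*q:ℝ) = y
        generalize (4:ℝ)^q = z
        generalize (C0:ℝ) = x
        rw [mul_pow, mul_pow]; ring
  have hQa : ∀ j, ‖aeval (u1^q) (Q k j)‖ ≤ (2 * C0 * 4^q)^(n+1) := by
    intro j
    have := norm_aeval_le (Q k j) (n+2) _ (2^q) (by have := hQd k j; omega) (hcR k j)
      (one_le_pow₀ (by norm_num)) (u1^q) (by rw [norm_pow]; gcongr)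
    refine this.trans ?_
    push_cast
    rw [← pow_mul]
    calc _ ≤ (2:ℝ)^(n+1) * ((C0:ℝ)^(n+1) * (4^q)^(n+1)) := by gcongr
      _ = _ := by rw [mul_pow, mul_pow]; ring
  have hsum : ‖∑ j : Fin (s+1), u1^(j:ℕ) * (u2^(s-(j:ℕ)) - 1) * aeval (u1^q) (Q k j)‖ ≤
      ‖u2-1‖ * ((s+1) * 2^s * (s*2^s) * (2 * C0 * 4^q)^(n+1)) := by
    refine (norm_sum_le _ _).trans ?_
    calc _ ≤ ∑ j : Fin (s+1), (2:ℝ)^s * (‖u2-1‖ * (s * 2^s)) * (2 * C0 * 4^q)^(n+1) := by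
          apply Finset.sum_le_sum
          intro j _
          rw [norm_mul, norm_mul, norm_pow]
          have a1 : ‖u1‖^(j:ℕ) ≤ 2^s :=
            (pow_le_pow_left₀ (norm_nonneg _) hu1n _).trans (pow_le_pow_right₀ (by norm_num) (by omega))
          have a2 := pow_sub_one_norm u2 hs2 s (s-j) (by omega)
          have a3 := hQa j
          gcongr
      _ = _ := by simp; ring
  have hup : ‖φ0 Z‖ ≤ (c2+1)^(n+1) * (‖u1-1‖^((s+1)*(n+1)) + ‖u2-1‖) := by
    set x1 := ‖u1-1‖^((s+1)*(n+1)) with hx1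
    set x2 := ‖u2-1‖ with hx2
    have hx1' : 0 ≤ x1 := by positivity
    have hx2' : 0 ≤ x2 := norm_nonneg _
    set A1 : ℝ := (2*q)^2 * C0 * 4^q with hA1
    set A2 : ℝ := (s+1) * 2^s * (s*2^s) with hA2
    set A3 : ℝ := 2 * C0 * 4^q with hA3
    have hA1' : 0 ≤ A1 := by positivity
    have hA2' : 0 ≤ A2 := by positivity
    have hA3' : 0 ≤ A3 := by positivity
    have hc2' : c2 = (‖θ‖^s + 1) * (A1 + A2 * A3) := hc2
    have hT : (0:ℝ) ≤ ‖θ‖^s := by positivity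
    rw [hφZ, norm_mul, norm_pow]
    have hA21 : A2 = 0 ∨ 1 ≤ A2 := by
      by_cases hs0 : s = 0
      · left; rw [hA2, hs0]; simp
      · right
        have h1 : (1:ℝ) ≤ s := by exact_mod_cast Nat.one_le_iff_ne_zero.2 hs0
        have h2 : (1:ℝ) ≤ 2^s := one_le_pow₀ (by norm_num)
        rw [hA2]
        exact one_le_mul_of_one_le_of_one_le (one_le_mul_of_one_le_of_one_le (by linarith) h2)
          (one_le_mul_of_one_le_of_one_le h1 h2)
    obtain ⟨p1, p2⟩ := core_aux n (‖θ‖^s) A1 A2 A3 hT hA1' hA2' hA3' hA21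
    rw [← hc2'] at p1 p2
    clear_value A1 A2 A3 x1 x2
    calc _ ≤ ‖θ‖^s * (x1 * A1^(n+1) + x2 * (A2 * A3^(n+1))) := by
          gcongr
          exact (norm_add_le _ _).trans (add_le_add hga2 hsum)
      _ = (‖θ‖^s * A1^(n+1)) * x1 + (‖θ‖^s * (A2 * A3^(n+1))) * x2 := by ring
      _ ≤ (c2+1)^(n+1) * x1 + (c2+1)^(n+1) * x2 := by gcongr
      _ = _ := by ring
  have hBc : Bd ≤ (c1+1)^(n+1) * (d:ℝ)^(2*(s*(M1+M2) + q*M1*(n+1))) := by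
    have hs1' : ((s:ℝ)+1) ≤ (s+1)^(n+1) := le_self_pow₀ (by linarith [show (0:ℝ) ≤ s by positivity]) (by omega)
    have hWr : (W:ℝ)^2 = ((b:ℝ)^2)^(n+1) * (d:ℝ)^(2*(s*(M1+M2) + q*M1*(n+1))) := by
      rw [hW]; push_cast
      rw [mul_pow (b:ℝ), ← pow_mul (d:ℝ) (q*M1), mul_comm 2 (s*(M1+M2) + _), pow_mul, pow_add]; ring
    rw [hBd, hWr]
    calc _ ≤ ((b:ℝ)^2)^(n+1) * (d:ℝ)^(2*(s*(M1+M2) + q*M1*(n+1))) * ((s+1)^(n+1) * (2^(n+1) * (C0:ℝ)^(n+1))) := by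
          gcongr
      _ = c1^(n+1) * (d:ℝ)^(2*(s*(M1+M2) + q*M1*(n+1))) := by
          rw [hc1, mul_pow, mul_pow, mul_pow]; ring
      _ ≤ _ := by
          gcongr
          linarith
  calc (1:ℝ) ≤ _ := hL2
    _ ≤ ((c1+1)^(n+1) * (d:ℝ)^(2*(s*(M1+M2) + q*M1*(n+1))))^(D+1) *
        ((c2+1)^(n+1) * (‖u1-1‖^((s+1)*(n+1)) + ‖u2-1‖)) := by gcongr
    _ = _ := by
      have : 2*(D+1)*(s*(M1+M2) + q*M1*(n+1)) = 2*(s*(M1+M2) + q*M1*(n+1)) * (D+1) := by ring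
      rw [this, pow_mul (d:ℝ) _ (D+1)]
      generalize (d:ℝ)^(2*(s*(M1+M2) + q*M1*(n+1))) = y
      generalize (‖u1-1‖^((s+1)*(n+1)) + ‖u2-1‖) = z
      generalize c1 + 1 = x
      generalize c2 + 1 = x'
      rw [mul_pow, mul_pow, ← pow_mul, ← pow_mul, mul_comm (n+1) (D+1)]; ring


set_option maxHeartbeats 1000000 in
lemma num_contra (E δ c C : ℝ) (hE : 0 < E) (hc : 1 ≤ c) (hC : 1 ≤ C) (s q : ℕ) (hsq : s < q)
    (h1 : 4*E ≤ (s+1)*δ) (h2 : 8*E*s ≤ q*δ) :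
    ∃ M0 : ℕ, ∀ M1 M2 : ℕ, M0 ≤ M1 → 1 ≤ M1 → q*M1 ≤ s*M2 → ∃ n : ℕ, ∀ x1 x2 : ℝ, 0 ≤ x1 → 0 ≤ x2 →
      x1 ≤ C * Real.exp (-δ*(q*M1)) → x2 ≤ C * Real.exp (-δ*(q*M2)) →
      c^(n+1) * Real.exp (E*(s*(M1+M2)+q*M1*(n+1))) * (x1^((s+1)*(n+1)) + x2) < 1 := by
  obtain ⟨lc, hlc0, rfl⟩ : ∃ l, 0 ≤ l ∧ c = Real.exp l :=
    ⟨Real.log c, Real.log_nonneg hc, (Real.exp_log (by linarith)).symm⟩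
  obtain ⟨lC, hlC0, rfl⟩ : ∃ l, 0 ≤ l ∧ C = Real.exp l :=
    ⟨Real.log C, Real.log_nonneg hC, (Real.exp_log (by linarith)).symm⟩
  obtain ⟨l2, hl20, hl2⟩ : ∃ l, 0 ≤ l ∧ (2:ℝ) = Real.exp l :=
    ⟨Real.log 2, Real.log_nonneg (by norm_num), (Real.exp_log (by linarith)).symm⟩
  obtain ⟨M0, hM0⟩ := exists_nat_gt ((lc + (s+1)*lC + l2)/E)
  refine ⟨M0, fun M1 M2 hM hM1 hqs => ?_⟩
  have hq0 : 0 < q := by omega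
  have hqM : 0 < q*M1 := by positivity
  refine ⟨s*M2/(q*M1), ?_⟩
  set n := s*M2/(q*M1) with hn
  have a1 : s*M2 ≤ q*M1*(n+1) := by
    have := Nat.lt_mul_div_succ (s*M2) hqM
    exact this.le
  have a2 : q*M1*(n+1) ≤ 2*(s*M2) := by
    have := Nat.mul_div_le (s*M2) (q*M1)
    rw [← hn] at this
    nlinarith
  intro x1 x2 hx1 hx2 hb1 hb2
  have r1 : (s:ℝ)*M2 ≤ q*M1*(n+1) := by exact_mod_cast a1
  have r2 : (q:ℝ)*M1*(n+1) ≤ 2*(s*M2) := by exact_mod_cast a2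
  have rsM : (s:ℝ)*M1 ≤ q*M1*(n+1) := by
    have : s*M1 ≤ q*M1*(n+1) := by
      calc s*M1 ≤ q*M1*1 := by nlinarith
        _ ≤ _ := Nat.mul_le_mul_left _ (Nat.le_add_left 1 n)
    exact_mod_cast this
  have hk : lc + (s+1)*lC + l2 < E*M1 := by
    rw [div_lt_iff₀ hE] at hM0
    have : (M0:ℝ) ≤ M1 := by exact_mod_cast hM
    nlinarith
  have hq1 : (1:ℝ) ≤ q := by exact_mod_cast hq0
  set t : ℝ := (n:ℝ)+1 with ht
  have ht1 : (1:ℝ) ≤ t := by rw [ht]; linarith [show (0:ℝ) ≤ n by positivity]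
  have hM1r : (1:ℝ) ≤ M1 := by exact_mod_cast hM1
  have hkt : t*(lc + (s+1)*lC + l2) < E*(q*M1*t) := by
    calc t*(lc + (s+1)*lC + l2) < t*(E*M1) := by gcongr
      _ = 1*(E*M1*t) := by ring
      _ ≤ q*(E*M1*t) := by gcongr
      _ = _ := by ring
  have hmain : t*lc + t*(s+1)*lC + l2 + E*(s*(M1+M2)+q*M1*t) < 4*E*(q*M1*t) := by
    have e1 : E*(s*(M1+M2)+q*M1*t) ≤ E*(3*(q*M1*t)) := by
      apply mul_le_mul_of_nonneg_left _ hE.le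
      nlinarith
    nlinarith
  have hY1 : 4*E*(q*M1*t) ≤ δ*(q*M1)*((s+1)*t) := by
    have := mul_le_mul_of_nonneg_right h1 (show (0:ℝ) ≤ q*M1*t by positivity)
    nlinarith
  have hY2 : 4*E*(q*M1*t) ≤ δ*(q*M2) := by
    have e1 := mul_le_mul_of_nonneg_left r2 (show 0 ≤ 4*E by positivity)
    have e2 := mul_le_mul_of_nonneg_right h2 (show (0:ℝ) ≤ M2 by positivity)
    nlinarith
  have hcp : Real.exp lc^(n+1) = Real.exp (t*lc) := by
    rw [← Real.exp_nat_mul]; push_cast; rw [ht]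
  have b1 : x1^((s+1)*(n+1)) ≤ Real.exp ((s+1)*t*(lC - δ*(q*M1))) := by
    calc _ ≤ (Real.exp lC * Real.exp (-δ*(q*M1)))^((s+1)*(n+1)) := by gcongr
      _ = _ := by
        rw [← Real.exp_add, ← Real.exp_nat_mul]; congr 1; push_cast; rw [ht]; ring
  have b2 : x2 ≤ Real.exp (lC - δ*(q*M2)) := by
    refine hb2.trans (le_of_eq ?_)
    rw [← Real.exp_add]; congr 1; ring
  have hh : Real.exp (-l2) = 1/2 := by rw [Real.exp_neg, ← hl2]; norm_num
  rw [hcp, ← Real.exp_add]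
  calc _ ≤ Real.exp (t*lc + E*(s*(M1+M2)+q*M1*t)) * (Real.exp ((s+1)*t*(lC - δ*(q*M1))) + Real.exp (lC - δ*(q*M2))) := by gcongr
    _ = Real.exp (t*lc + E*(s*(M1+M2)+q*M1*t) + (s+1)*t*(lC - δ*(q*M1))) +
        Real.exp (t*lc + E*(s*(M1+M2)+q*M1*t) + (lC - δ*(q*M2))) := by
          rw [mul_add, ← Real.exp_add, ← Real.exp_add]
    _ < Real.exp (-l2) + Real.exp (-l2) := by
          have hlC' : lC ≤ t*(s+1)*lC := by
            have : (1:ℝ) ≤ t*(s+1) := one_le_mul_of_one_le_of_one_le ht1 (by linarith [show (0:ℝ) ≤ s by positivity])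
            exact le_mul_of_one_le_left hlC0 this
          have z1 : (s+1)*t*(lC - δ*(q*M1)) = t*(s+1)*lC - δ*(q*M1)*((s+1)*t) := by ring
          refine add_lt_add (Real.exp_lt_exp.2 ?_) (Real.exp_lt_exp.2 ?_)
          · rw [z1]; linarith
          · linarith
    _ = 1 := by rw [hh]; norm_num

lemma finite_sum_le {ι : Type*} [Fintype ι] (N : ℕ) : {n : ι → ℕ | ∑ i, n i ≤ N}.Finite := by
  classical
  apply (Set.finite_Iic (fun _ : ι => N)).subset
  intro n hn i
  exact (Finset.single_le_sum (fun _ _ => Nat.zero_le _) (Finset.mem_univ i)).trans hn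

lemma exists_denom {K : Type*} [Field K] [NumberField K] (x : K) :
    ∃ d : ℕ, 1 ≤ d ∧ ∀ e : ℕ, d ∣ e → 1 ≤ e → IsIntegral ℤ ((e:K)*x) ∧ ∀ φ : K →+* ℂ, ‖φ x‖ ≤ e := by
  classical
  have halg : IsAlgebraic ℤ x := (IsFractionRing.isAlgebraic_iff ℤ ℚ K).2 (Algebra.IsAlgebraic.isAlgebraic x)
  obtain ⟨y, hy0, hy⟩ := halg.exists_integral_multiple
  obtain ⟨N, hN⟩ := exists_nat_gt (∑ φ : K →+* ℂ, ‖φ x‖)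
  have hN0 : 0 < N := by
    have : (0:ℝ) ≤ ∑ φ : K →+* ℂ, ‖φ x‖ := Finset.sum_nonneg (fun _ _ => norm_nonneg _)
    exact_mod_cast this.trans_lt hN
  refine ⟨y.natAbs * N, Nat.succ_le_of_lt (Nat.mul_pos (Int.natAbs_pos.2 hy0) hN0), ?_⟩
  intro e he he1
  constructor
  · obtain ⟨k, rfl⟩ := he
    have : ∃ l : ℤ, ((y.natAbs * N * k : ℕ) : ℤ) = l * y := by
      have : y ∣ ((y.natAbs * N * k : ℕ) : ℤ) := by
        rw [Nat.cast_mul, Nat.cast_mul]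
        exact Dvd.dvd.mul_right (Dvd.dvd.mul_right (Int.dvd_natAbs_self) _) _
      obtain ⟨l, hl⟩ := this
      exact ⟨l, by rw [hl, mul_comm]⟩
    obtain ⟨l, hl⟩ := this
    have e2 : ((y.natAbs * N * k : ℕ) : K) * x = (l:K) * (y • x) := by
      rw [zsmul_eq_mul, ← mul_assoc]
      congr 1
      have := congrArg (fun z : ℤ => (z : K)) hl
      simp only [Int.cast_mul, Int.cast_natCast] at this
      exact this
    rw [e2]
    refine IsIntegral.mul ?_ hy
    simpa using isIntegral_algebraMap (R := ℤ) (A := K) (x := l)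
  · intro φ
    have h1 : ‖φ x‖ ≤ ∑ φ : K →+* ℂ, ‖φ x‖ :=
      Finset.single_le_sum (f := fun φ : K →+* ℂ => ‖φ x‖) (fun _ _ => norm_nonneg _) (Finset.mem_univ φ)
    have h2 : N ≤ e := Nat.le_of_dvd he1 ((Dvd.intro_left _ rfl).trans he)
    have h3 : (N:ℝ) ≤ e := by exact_mod_cast h2
    linarith

lemma G1 {K : Type*} [Field K] [NumberField K] (φ0 : K →+* ℂ) {ι : Type*} [Fintype ι]
    (α : ι → K) (hα : ∀ i, α i ≠ 0) (β : K) (θ : ℂ) (d : ℕ) (hd : 2 ≤ d)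
    (hdi : ∀ i, IsIntegral ℤ ((d:K) * α i)) (hdn : ∀ i, ∀ φ : K →+* ℂ, ‖φ (α i)‖ ≤ d)
    (C δ : ℝ) (hC : 1 ≤ C) (hδ : 0 < δ) (s q : ℕ) (hs : 1 ≤ s) (hsq : s < q)
    (h1 : 4*(2*(Module.finrank ℚ K + 1)*Real.log d) ≤ (s+1)*δ)
    (h2 : 8*(2*(Module.finrank ℚ K + 1)*Real.log d)*s ≤ q*δ) :
    {m : ι → ℕ | β * (∏ i, α i^m i)^q ≠ 1 ∧ ∃ u : ℂ, u^q = φ0 (β * (∏ i, α i^m i)^q) ∧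
      φ0 (∏ i, α i^m i) = θ * u ∧ ‖u - 1‖ ≤ C * Real.exp (-δ*(q*(∑ i, m i : ℕ)))}.Finite := by
  classical
  by_contra hinf
  have hex : ∀ N : ℕ, ∃ m ∈ {m : ι → ℕ | β * (∏ i, α i^m i)^q ≠ 1 ∧ ∃ u : ℂ, u^q = φ0 (β * (∏ i, α i^m i)^q) ∧
      φ0 (∏ i, α i^m i) = θ * u ∧ ‖u - 1‖ ≤ C * Real.exp (-δ*(q*(∑ i, m i : ℕ)))}, N ≤ ∑ i, m i := by
    intro N
    by_contra hcon
    push Not at hcon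
    exact hinf ((finite_sum_le N).subset (fun m hm => (hcon m hm).le))
  have hd1 : (1:ℝ) < d := by exact_mod_cast (by omega : 1 < d)
  have hlog : 0 < Real.log d := Real.log_pos hd1
  obtain ⟨b, hb1, hb⟩ := exists_denom β
  obtain ⟨hbi, hbn⟩ := hb b dvd_rfl hb1
  obtain ⟨c, hc, hcore⟩ := core φ0 q s hsq b d hb1 (by omega) β θ hbi hbn
  obtain ⟨M0, hM0⟩ := num_contra (2*(Module.finrank ℚ K + 1)*Real.log d) δ c C (by positivity) hc hC s q hsq h1 h2
  have hgi : ∀ m : ι → ℕ, IsIntegral ℤ ((d:K)^(∑ i, m i) * ∏ i, α i^m i) := by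
    intro m
    rw [← Finset.prod_pow_eq_pow_sum, ← Finset.prod_mul_distrib]
    apply IsIntegral.prod
    intro i _
    rw [← mul_pow]
    exact (hdi i).pow _
  have hgn : ∀ m : ι → ℕ, ∀ φ : K →+* ℂ, ‖φ (∏ i, α i^m i)‖ ≤ (d:ℝ)^(∑ i, m i) := by
    intro m φ
    rw [← Finset.prod_pow_eq_pow_sum, map_prod, norm_prod]
    apply Finset.prod_le_prod (fun _ _ => norm_nonneg _)
    intro i _
    rw [map_pow, norm_pow]
    exact pow_le_pow_left₀ (norm_nonneg _) (hdn i φ) _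
  have hg0 : ∀ m : ι → ℕ, (∏ i, α i^m i) ≠ 0 := fun m =>
    Finset.prod_ne_zero_iff.2 (fun i _ => pow_ne_zero _ (hα i))
  obtain ⟨M', hM'⟩ := exists_nat_gt (Real.log C / δ)
  have hle1 : ∀ M : ℕ, M' ≤ M → C * Real.exp (-δ*(q*M)) ≤ 1 := by
    intro M hM
    have hq1 : (1:ℝ) ≤ q := by exact_mod_cast (by omega : 1 ≤ q)
    have hMr : (M':ℝ) ≤ M := by exact_mod_cast hM
    rw [div_lt_iff₀ hδ] at hM'
    have : Real.log C ≤ δ*(q*M) := by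
      have h3 : (M:ℝ) ≤ q*M := by nlinarith [show (0:ℝ) ≤ M by positivity]
      nlinarith
    calc C * Real.exp (-δ*(q*M)) = Real.exp (Real.log C) * Real.exp (-δ*(q*M)) := by rw [Real.exp_log (by linarith)]
      _ = Real.exp (Real.log C - δ*(q*M)) := by rw [← Real.exp_add]; congr 1; ring
      _ ≤ 1 := Real.exp_le_one_iff.2 (by linarith)
  obtain ⟨m1, ⟨hne1, u1, hu1q, hu1, hu1n⟩, hm1⟩ := hex (M0 + M' + 1)
  obtain ⟨m2, ⟨-, u2, hu2q, hu2, hu2n⟩, hm2⟩ := hex (q * (∑ i, m1 i) + M')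
  set M1 := ∑ i, m1 i with hM1
  set M2 := ∑ i, m2 i with hM2
  obtain ⟨n, hn⟩ := hM0 M1 M2 (by omega) (by omega) (by nlinarith)
  have hlt := hn ‖u1-1‖ ‖u2-1‖ (norm_nonneg _) (norm_nonneg _) hu1n hu2n
  have hge := hcore n M1 M2 _ _ u1 u2 (hgi m1) (hgi m2) (hgn m1) (hgn m2) (hg0 m1) hu1 hu2 hu1q hne1
    (hu1n.trans (hle1 _ (by omega))) (hu2n.trans (hle1 _ (by omega)))
  have e : (d:ℝ)^(2*(Module.finrank ℚ K+1)*(s*(M1+M2) + q*M1*(n+1))) =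
      Real.exp (2*(Module.finrank ℚ K + 1)*Real.log d * (s*(M1+M2)+q*M1*(n+1))) := by
    have : (d:ℝ) = Real.exp (Real.log d) := (Real.exp_log (by linarith)).symm
    conv_lhs => rw [this]
    rw [← Real.exp_nat_mul]
    congr 1; push_cast; ring
  rw [e] at hge
  linarith

lemma thmG' {K : Type*} [Field K] [NumberField K] (φ0 : K →+* ℂ) {ι : Type*} [Fintype ι]
    (α : ι → K) (hα : ∀ i, α i ≠ 0) (β : K) (hβ : β ≠ 0) (C δ : ℝ) (hδ : 0 < δ) :
    {n : ι → ℕ | β * ∏ i, α i^n i ≠ 1 ∧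
      ‖φ0 (β * ∏ i, α i^n i) - 1‖ ≤ C * Real.exp (-δ*(∑ i, n i : ℕ))}.Finite := by
  classical
  choose dd hdd1 hdd using fun i => exists_denom (α i)
  set d := 2 * ∏ i, dd i with hd
  have hp1 : 1 ≤ ∏ i, dd i := Finset.one_le_prod' (fun i _ => hdd1 i)
  have hd2 : 2 ≤ d := by omega
  have hdiv : ∀ i, dd i ∣ d := fun i => (Finset.dvd_prod_of_mem dd (Finset.mem_univ i)).mul_left 2
  set E : ℝ := 2*(Module.finrank ℚ K + 1)*Real.log d with hE
  obtain ⟨s, hs⟩ := exists_nat_gt (4*E/δ)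
  rw [div_lt_iff₀ hδ] at hs
  obtain ⟨q, hq⟩ := exists_nat_gt (8*E*(s+1:ℕ)/δ)
  rw [div_lt_iff₀ hδ] at hq
  -- use s+1 and q+s+2
  set C' : ℝ := 3 * |C| + 1 with hC'
  have hfin := fun (r : ι → Fin (q+s+2)) (θ : ℂ) =>
    G1 φ0 α hα (β * ∏ i, α i^(r i:ℕ)) θ d hd2 (fun i => (hdd i d (hdiv i) (by omega)).1)
      (fun i => (hdd i d (hdiv i) (by omega)).2) C' δ (by rw [hC']; linarith [abs_nonneg C]) hδ (s+1) (q+s+2)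
      (by omega) (by omega) (by push_cast; nlinarith) (by push_cast at hq ⊢; nlinarith [show (0:ℝ) ≤ s by positivity])
  set F : (ι → Fin (q+s+2)) → Set ℂ := fun r => {θ | θ^(q+s+2) = (φ0 (β * ∏ i, α i^(r i:ℕ)))⁻¹} with hF
  have hFfin : ∀ r, (F r).Finite := by
    intro r
    apply (Polynomial.nthRoots (q+s+2) (φ0 (β * ∏ i, α i^(r i:ℕ)))⁻¹).toFinset.finite_toSet.subset
    intro θ hθ
    simp only [Finset.mem_coe, Multiset.mem_toFinset]
    exact (Polynomial.mem_nthRoots (by omega)).2 hθ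
  obtain ⟨N, hN⟩ := exists_nat_gt (Real.log (2*(|C|+1)) / δ)
  rw [div_lt_iff₀ hδ] at hN
  have hsmall : ∀ M : ℕ, N ≤ M → C * Real.exp (-δ*M) ≤ 1/2 := by
    intro M hM
    have hMr : (N:ℝ) ≤ M := by exact_mod_cast hM
    have h0 : (0:ℝ) < 2*(|C|+1) := by positivity
    have : Real.exp (-δ*M) ≤ (2*(|C|+1))⁻¹ := by
      rw [← Real.exp_log (inv_pos.2 h0), Real.log_inv]
      apply Real.exp_le_exp.2
      nlinarith
    calc C * Real.exp (-δ*M) ≤ (|C|+1) * (2*(|C|+1))⁻¹ := by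
          gcongr
          linarith [le_abs_self C]
      _ = 1/2 := by field_simp
  apply ((finite_sum_le N).union (Set.finite_iUnion (fun r => (hFfin r).biUnion (fun θ _ =>
    (hfin r θ).image (fun m i => (q+s+2) * m i + (r i : ℕ)))))).subset
  rintro n ⟨hn1, hn2⟩
  by_cases hnN : ∑ i, n i ≤ N
  · exact Or.inl hnN
  right
  push Not at hnN
  have hw := hn2.trans (hsmall _ hnN.le)
  obtain ⟨u, hu, hu1⟩ := exists_root (q+s+2) (by omega) _ hw
  set r : ι → Fin (q+s+2) := fun i => ⟨n i % (q+s+2), Nat.mod_lt _ (by omega)⟩ with hr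
  set m : ι → ℕ := fun i => n i / (q+s+2) with hm
  have hnm : ∀ i, (q+s+2) * m i + (r i:ℕ) = n i := fun i => Nat.div_add_mod _ _
  set γ := ∏ i, α i^m i with hγ
  set β' := β * ∏ i, α i^(r i:ℕ) with hβ'
  have hγ0 : γ ≠ 0 := Finset.prod_ne_zero_iff.2 (fun i _ => pow_ne_zero _ (hα i))
  have hβ'0 : β' ≠ 0 := mul_ne_zero hβ (Finset.prod_ne_zero_iff.2 (fun i _ => pow_ne_zero _ (hα i)))
  have hww : β * ∏ i, α i^n i = β' * γ^(q+s+2) := by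
    rw [hβ', hγ, ← Finset.prod_pow, mul_assoc, ← Finset.prod_mul_distrib]
    congr 1
    apply Finset.prod_congr rfl
    intro i _
    rw [← pow_mul, ← pow_add]
    congr 1
    have := hnm i
    rw [← this]; ring
  rw [hww] at hu hu1 hn1 hn2
  have hu0 : u ≠ 0 := by
    rintro rfl
    rw [zero_pow (by omega)] at hu
    exact (mul_ne_zero hβ'0 (pow_ne_zero _ hγ0)) ((map_eq_zero φ0).1 hu.symm)
  refine Set.mem_iUnion.2 ⟨r, Set.mem_iUnion₂.2 ⟨φ0 γ / u, ?_, m, ⟨hn1, u, hu, ?_, ?_⟩, ?_⟩⟩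
  · have hb0 : φ0 β' ≠ 0 := (map_ne_zero φ0).2 hβ'0
    have hg0 : φ0 γ ≠ 0 := (map_ne_zero φ0).2 hγ0
    change (φ0 γ / u)^(q+s+2) = (φ0 β')⁻¹
    rw [div_pow, hu, map_mul, map_pow]
    field_simp
  · rw [← hγ]; field_simp
  · have hsum : (q+s+2) * ∑ i, m i ≤ ∑ i, n i := by
      rw [Finset.mul_sum]
      exact Finset.sum_le_sum (fun i _ => by have := hnm i; omega)
    have hsr : (((q+s+2:ℕ):ℝ) * ((∑ i, m i : ℕ):ℝ)) ≤ ((∑ i, n i : ℕ):ℝ) := by exact_mod_cast hsum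
    calc ‖u-1‖ ≤ 3 * (C * Real.exp (-δ*(∑ i, n i : ℕ))) := by linarith
      _ = (3*C) * Real.exp (-δ*(∑ i, n i : ℕ)) := by ring
      _ ≤ C' * Real.exp (-δ*(((q+s+2:ℕ):ℝ) * ((∑ i, m i : ℕ):ℝ))) := by
          have : 3*C ≤ C' := by rw [hC']; linarith [le_abs_self C]
          have h2 : -δ*((∑ i, n i : ℕ):ℝ) ≤ -δ*(((q+s+2:ℕ):ℝ) * ((∑ i, m i : ℕ):ℝ)) := by nlinarith
          have h3 : 0 ≤ C' := by positivity
          gcongr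
  · funext i; exact hnm i

lemma thmG {ι : Type*} [Fintype ι]
    (α : ι → ℂ) (hα : ∀ i, α i ≠ 0) (hαa : ∀ i, IsAlgebraic ℚ (α i)) (β : ℂ) (hβ : β ≠ 0)
    (hβa : IsAlgebraic ℚ β) (C δ : ℝ) (hδ : 0 < δ) :
    {n : ι → ℕ | β * ∏ i, α i^n i ≠ 1 ∧
      ‖β * ∏ i, α i^n i - 1‖ ≤ C * Real.exp (-δ*(∑ i, n i : ℕ))}.Finite := by
  classical
  set S : Set ℂ := insert β (Set.range α) with hS
  have hSf : S.Finite := (Set.finite_range α).insert β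
  have hSa : ∀ x ∈ S, IsIntegral ℚ x := by
    rintro x (rfl | ⟨i, rfl⟩)
    · exact hβa.isIntegral
    · exact (hαa i).isIntegral
  set K := IntermediateField.adjoin ℚ S with hK
  have : Finite S := hSf
  have : FiniteDimensional ℚ K := IntermediateField.finiteDimensional_adjoin hSa
  have : NumberField K := { to_charZero := inferInstance, to_finiteDimensional := inferInstance }
  have hmem : ∀ x ∈ S, x ∈ K := fun x hx => IntermediateField.subset_adjoin ℚ S hx
  have hβK : β ∈ K := hmem _ (Or.inl rfl)
  have hαK : ∀ i, α i ∈ K := fun i => hmem _ (Or.inr ⟨i, rfl⟩)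
  have := thmG' (algebraMap K ℂ) (fun i => (⟨α i, hαK i⟩ : K)) (fun i h => hα i (congrArg Subtype.val h))
    (⟨β, hβK⟩ : K) (fun h => hβ (congrArg Subtype.val h)) C δ hδ
  apply this.subset
  rintro n ⟨h1, h2⟩
  have e : (algebraMap K ℂ) ((⟨β, hβK⟩ : K) * ∏ i, (⟨α i, hαK i⟩ : K)^n i) = β * ∏ i, α i^n i := by
    rw [map_mul, map_prod]
    simp only [map_pow]
    rfl
  refine ⟨fun h => h1 ?_, ?_⟩
  · rw [← e, h, map_one]
  · rw [e]; exact h2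


lemma exists_exp_le {ι : Type*} [Finite ι] (x : ι → ℝ) (hx : ∀ i, 1 < x i) :
    ∃ δ : ℝ, 0 < δ ∧ ∀ i, Real.exp δ ≤ x i := by
  rcases isEmpty_or_nonempty ι with h | h
  · exact ⟨1, one_pos, fun i => (h.false i).elim⟩
  · obtain ⟨i0, hi0⟩ := Finite.exists_min x
    refine ⟨Real.log (x i0), Real.log_pos (hx i0), fun i => ?_⟩
    rw [Real.exp_log (by linarith [hx i0])]
    exact hi0 i

lemma exp_le_prod {ι : Type*} [Fintype ι] (x : ι → ℝ) (δ : ℝ) (hx : ∀ i, Real.exp δ ≤ x i) (n : ι → ℕ) :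
    Real.exp (δ * (∑ i, n i : ℕ)) ≤ ∏ i, x i^n i := by
  rw [mul_comm, Real.exp_nat_mul, ← Finset.prod_pow_eq_pow_sum]
  apply Finset.prod_le_prod
  · intro i _; positivity
  · intro i _; exact pow_le_pow_left₀ (Real.exp_pos _).le (hx i) _

lemma alg_ofReal {x : ℝ} (h : IsAlgebraic ℚ x) : IsAlgebraic ℚ (x : ℂ) := h.algebraMap (A := ℂ)

lemma alg_I : IsAlgebraic ℚ Complex.I := by
  apply IsAlgebraic.of_pow (n := 2) (by norm_num)
  rw [Complex.I_sq]
  exact isAlgebraic_one.neg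

lemma alg_mk {z : ℂ} (h1 : IsAlgebraic ℚ z.re) (h2 : IsAlgebraic ℚ z.im) : IsAlgebraic ℚ z := by
  rw [← Complex.re_add_im z]
  exact (alg_ofReal h1).add ((alg_ofReal h2).mul alg_I)

lemma complex_part {ι κ : Type*} [Fintype ι] [Fintype κ] (z : ι → ℂ) (v : κ → ℝ) (A B : ℝ) (c : ℂ)
    (hz1 : ∀ i, IsAlgebraic ℚ (z i).re) (hz2 : ∀ i, IsAlgebraic ℚ (z i).im) (hz : ∀ i, 1 < ‖z i‖)
    (hva : ∀ j, IsAlgebraic ℚ (v j)) (hv : ∀ j, 1 < v j)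
    (hA : 0 < A) (hB : 0 < B) (hAa : IsAlgebraic ℚ A) (hBa : IsAlgebraic ℚ B)
    (hc1 : IsAlgebraic ℚ c.re) (hc2 : IsAlgebraic ℚ c.im) :
    {n : ι → ℕ | ∃ m : κ → ℕ, A * ‖∏ i, z i^n i‖^2 + 1 - 2 * (c * ∏ i, z i^n i).re = B * ∏ j, v j^m j}.Finite := by
  classical
  obtain ⟨δ1, hδ1, hd1⟩ := exists_exp_le (fun i => ‖z i‖) hz
  obtain ⟨δ2, hδ2, hd2⟩ := exists_exp_le v hv
  set δ := min δ1 δ2 with hδ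
  have hδ0 : 0 < δ := lt_min hδ1 hδ2
  have hdz : ∀ i, Real.exp δ ≤ ‖z i‖ := fun i => (Real.exp_le_exp.2 (min_le_left _ _)).trans (hd1 i)
  have hdv : ∀ i, Real.exp δ ≤ v i := fun i => (Real.exp_le_exp.2 (min_le_right _ _)).trans (hd2 i)
  have hZ : ∀ n : ι → ℕ, Real.exp (δ * (∑ i, n i : ℕ)) ≤ ‖∏ i, z i^n i‖ := by
    intro n
    rw [norm_prod]
    simp only [norm_pow]
    exact exp_le_prod _ δ hdz n
  have hZ1 : ∀ n : ι → ℕ, 1 ≤ ‖∏ i, z i^n i‖ := fun n =>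
    (Real.one_le_exp (by positivity)).trans (hZ n)
  have hz0 : ∀ i, z i ≠ 0 := fun i h => by have := hz i; rw [h] at this; norm_num at this
  have hconj : ∀ w : ℂ, IsAlgebraic ℚ w.re → IsAlgebraic ℚ w.im → IsAlgebraic ℚ ((starRingEnd ℂ) w) :=
    fun w h1 h2 => alg_mk (by simpa using h1) (by simpa using h2.neg)
  set C1 : ℝ := (A + 1 + 2*‖c‖)/B with hC1
  have hC10 : 0 ≤ C1 := by positivity
  -- first set
  have F1 := thmG (ι := ι ⊕ κ) (Sum.elim (fun i => (((‖z i‖^2)⁻¹ : ℝ) : ℂ)) (fun j => ((v j : ℝ):ℂ)))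
    (by
      rintro (i | j)
      · simp [hz0 i]
      · simp; have := hv j; linarith)
    (by
      rintro (i | j)
      · apply alg_ofReal
        apply IsAlgebraic.inv
        rw [← Complex.normSq_eq_norm_sq, Complex.normSq_apply]
        exact ((hz1 i).mul (hz1 i)).add ((hz2 i).mul (hz2 i))
      · exact alg_ofReal (hva j))
    (((B/A : ℝ)):ℂ) (by exact_mod_cast (by positivity : B/A ≠ 0)) (alg_ofReal (by rw [div_eq_mul_inv]; exact hBa.mul hAa.inv))
    ((1+2*‖c‖)/A * (C1+1)) (δ/3) (by positivity)
  have F2 : c ≠ 0 → _ := fun hc => thmG (fun i => z i / (starRingEnd ℂ) (z i))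
    (fun i => div_ne_zero (hz0 i) ((_root_.map_ne_zero _).2 (hz0 i)))
    (fun i => by rw [div_eq_mul_inv]; exact (alg_mk (hz1 i) (hz2 i)).mul (hconj _ (hz1 i) (hz2 i)).inv)
    (-(c / (starRingEnd ℂ) c)) (neg_ne_zero.2 (div_ne_zero hc ((_root_.map_ne_zero _).2 hc)))
    (by rw [div_eq_mul_inv]; exact ((alg_mk hc1 hc2).mul (hconj _ hc1 hc2).inv).neg) (‖c‖⁻¹) δ hδ0
  have F3 : (if h : c ≠ 0 then {n : ι → ℕ | (-(c / (starRingEnd ℂ) c)) * ∏ i, (z i / (starRingEnd ℂ) (z i))^n i ≠ 1 ∧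
      ‖(-(c / (starRingEnd ℂ) c)) * ∏ i, (z i / (starRingEnd ℂ) (z i))^n i - 1‖ ≤ ‖c‖⁻¹ * Real.exp (-δ*(∑ i, n i : ℕ))} else ∅).Finite := by
    split_ifs with h
    · exact F2 h
    · exact Set.finite_empty
  apply ((F1.image (fun N i => N (Sum.inl i))).union F3).subset
  rintro n ⟨m, hnm⟩
  set Z := ∏ i, z i^n i with hZd
  set V := ∏ j, v j^m j with hVd
  have hZn := hZ n
  have hZ1n := hZ1 n
  rw [← hZd] at hZn hZ1n
  have hcZ : |(c*Z).re| ≤ ‖c‖*‖Z‖ := (Complex.abs_re_le_norm _).trans (norm_mul _ _).le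
  have hcZ' := abs_le.1 hcZ
  have hc0 := norm_nonneg c
  have hVe : Real.exp (δ * (∑ i, m i : ℕ)) ≤ V := exp_le_prod v δ hdv m
  have hVle : V ≤ C1 * ‖Z‖^2 := by
    rw [hC1, div_mul_eq_mul_div, le_div_iff₀ hB]
    have : ‖Z‖ ≤ ‖Z‖^2 := by nlinarith
    nlinarith
  have hZ0 : Z ≠ 0 := fun h => by rw [h] at hZ1n; norm_num at hZ1n
  by_cases hcase : B * V = A * ‖Z‖^2
  · right
    have h1 : 2 * (c*Z).re = 1 := by linarith
    have hc : c ≠ 0 := by rintro rfl; simp at h1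
    rw [dif_pos hc]
    have hsum : c*Z + (starRingEnd ℂ) (c*Z) = 1 := by
      rw [Complex.add_conj]; exact_mod_cast h1
    have hw : (-(c / (starRingEnd ℂ) c)) * ∏ i, (z i / (starRingEnd ℂ) (z i))^n i =
        -(c*Z) / (starRingEnd ℂ) (c*Z) := by
      simp only [div_pow]
      rw [Finset.prod_div_distrib, hZd, map_mul, map_prod]
      simp only [map_pow]
      rw [neg_div, mul_div_mul_comm]; ring
    have hcZ0 : (starRingEnd ℂ) (c*Z) ≠ 0 := (_root_.map_ne_zero _).2 (mul_ne_zero hc hZ0)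
    have hw1 : -(c*Z) / (starRingEnd ℂ) (c*Z) - 1 = -((starRingEnd ℂ) (c*Z))⁻¹ := by
      field_simp
      linear_combination -hsum
    constructor
    · rw [hw]
      intro h
      rw [h, sub_self] at hw1
      exact (neg_ne_zero.2 (inv_ne_zero hcZ0)) hw1.symm
    · rw [hw, hw1, norm_neg, norm_inv, Complex.norm_conj, norm_mul, mul_inv]
      gcongr
      rw [neg_mul, Real.exp_neg]
      gcongr
  · left
    refine ⟨Sum.elim n m, ⟨?_, ?_⟩, rfl⟩
    all_goals
      have hw : (((B/A : ℝ)):ℂ) * ∏ i, (Sum.elim (fun i => (((‖z i‖^2)⁻¹ : ℝ) : ℂ)) (fun j => ((v j : ℝ):ℂ)) i)^(Sum.elim n m i) = ((B*V/(A*‖Z‖^2) : ℝ) : ℂ) := by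
        rw [Fintype.prod_sum_type]
        simp only [Sum.elim_inl, Sum.elim_inr]
        have : B*V/(A*‖Z‖^2) = (B/A) * ((∏ i, ((‖z i‖^2)⁻¹)^n i) * ∏ j, v j^m j) := by
          have : ‖Z‖^2 = ∏ i, (‖z i‖^2)^n i := by
            rw [hZd, norm_prod, ← Finset.prod_pow]
            apply Finset.prod_congr rfl
            intro i _
            rw [norm_pow, ← pow_mul, ← pow_mul, mul_comm]
          rw [this, ← hVd]
          simp only [inv_pow]
          rw [Finset.prod_inv_distrib]
          field_simp
        rw [this]
        push_cast
        ring
      have hAZ : 0 < A*‖Z‖^2 := by positivity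
      rw [hw]
    · intro h
      have h' : B*V/(A*‖Z‖^2) = 1 := by exact_mod_cast h
      rw [div_eq_one_iff_eq hAZ.ne'] at h'
      exact hcase h'
    · have e1 : ‖((B*V/(A*‖Z‖^2) : ℝ) : ℂ) - 1‖ = |1 - 2*(c*Z).re|/(A*‖Z‖^2) := by
        rw [← Complex.ofReal_one, ← Complex.ofReal_sub, Complex.norm_real, Real.norm_eq_abs]
        rw [← abs_of_pos hAZ, ← abs_div, abs_of_pos hAZ]
        congr 1
        field_simp
        linarith
      have e2 : |1 - 2*(c*Z).re|/(A*‖Z‖^2) ≤ (1+2*‖c‖)/A * ‖Z‖⁻¹ := by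
        rw [div_le_iff₀ hAZ]
        have : (1+2*‖c‖)/A * ‖Z‖⁻¹ * (A*‖Z‖^2) = (1+2*‖c‖)*‖Z‖ := by
          have : ‖Z‖ ≠ 0 := by positivity
          field_simp
        rw [this, abs_le]
        constructor <;> nlinarith
      rw [e1]
      refine e2.trans ?_
      rw [Fintype.sum_sum_type]
      simp only [Sum.elim_inl, Sum.elim_inr]
      rw [mul_assoc]
      gcongr
      set s : ℕ := ∑ i, n i + ∑ j, m j with hs
      have h3 : Real.exp (δ/3*s) ≤ (C1+1)*‖Z‖ := by
        rw [← pow_le_pow_iff_left₀ (Real.exp_pos _).le (by positivity) (three_ne_zero)]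
        calc Real.exp (δ/3*s)^3 = Real.exp (δ * (∑ i, n i : ℕ)) * Real.exp (δ * (∑ i, m i : ℕ)) := by
              rw [← Real.exp_nat_mul, ← Real.exp_add]
              congr 1
              rw [hs]; push_cast; ring
          _ ≤ ‖Z‖ * (C1 * ‖Z‖^2) := by
              gcongr
              exact hVe.trans hVle
          _ = C1 * ‖Z‖^3 := by ring
          _ ≤ (C1+1)^3 * ‖Z‖^3 := by
              gcongr
              calc C1 ≤ C1 + 1 := by linarith
                _ ≤ _ := le_self_pow₀ (by linarith) (by norm_num)
          _ = _ := by ring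
      rw [neg_mul, Real.exp_neg, ← div_eq_mul_inv, le_div_iff₀ (Real.exp_pos _), inv_mul_le_iff₀ (by linarith)]
      rw [mul_comm ‖Z‖]
      exact h3

end Helpers

lemma closure_prod {M N : Type*} [Mul M] [CommMonoid N] (S : Finset M) (R : M → N → Prop) (z : S → N)
    (hS : ∀ s : S, R s (z s)) (hm : ∀ x y a b, R x a → R y b → R (x*y) (a*b)) (x : M)
    (hx : x ∈ Subsemigroup.closure (S : Set M)) : ∃ n : S → ℕ, R x (∏ i, z i^n i) := by
  classical
  induction hx using Subsemigroup.closure_induction with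
  | mem x hx =>
    refine ⟨Pi.single ⟨x, hx⟩ 1, ?_⟩
    have : ∏ i, z i^((Pi.single (⟨x, hx⟩ : S) 1 : S → ℕ) i) = z ⟨x, hx⟩ := by
      rw [Finset.prod_eq_single (⟨x, hx⟩ : S)]
      · simp
      · intro j _ hj
        rw [Pi.single_eq_of_ne hj, pow_zero]
      · intro h; exact absurd (Finset.mem_univ _) h
    rw [this]
    exact hS ⟨x, hx⟩
  | mul x y _ _ ihx ihy =>
    obtain ⟨n, hn⟩ := ihx
    obtain ⟨m, hm'⟩ := ihy
    refine ⟨n + m, ?_⟩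
    simp only [Pi.add_apply, pow_add, Finset.prod_mul_distrib]
    exact hm _ _ _ _ hn hm'

lemma exists_i0 (S : Finset ℍ[ℝ]) (hS : ∀ g ∈ S, AlgQuat g) (hc : ∀ x ∈ S, ∀ y ∈ S, x * y = y * x) :
    ∃ i0 : ℍ[ℝ], AlgQuat i0 ∧ i0.re = 0 ∧ i0.imI^2 + i0.imJ^2 + i0.imK^2 = 1 ∧
      ∀ s ∈ S, ∃ y : ℝ, IsAlgebraic ℚ y ∧ s.imI = y * i0.imI ∧ s.imJ = y * i0.imJ ∧ s.imK = y * i0.imK := by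
  by_cases h : ∀ s ∈ S, s.imI = 0 ∧ s.imJ = 0 ∧ s.imK = 0
  · refine ⟨⟨0, 1, 0, 0⟩, ⟨isAlgebraic_zero, isAlgebraic_one, isAlgebraic_zero, isAlgebraic_zero⟩, rfl, by norm_num, ?_⟩
    intro s hs
    obtain ⟨h1, h2, h3⟩ := h s hs
    exact ⟨0, isAlgebraic_zero, by simp [h1], by simp [h2], by simp [h3]⟩
  · push Not at h
    obtain ⟨s0, hs0, hne⟩ := h
    obtain ⟨-, a1, a2, a3⟩ := hS s0 hs0
    set x := s0.imI with hx
    set y := s0.imJ with hy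
    set z := s0.imK with hz
    have hpos : 0 < x^2 + y^2 + z^2 := by
      by_contra hcon
      have h1 : x = 0 := by nlinarith [sq_nonneg x, sq_nonneg y, sq_nonneg z]
      have h2 : y = 0 := by nlinarith [sq_nonneg x, sq_nonneg y, sq_nonneg z]
      have h3 : z = 0 := by nlinarith [sq_nonneg x, sq_nonneg y, sq_nonneg z]
      exact hne h1 h2 h3
    set ρ := Real.sqrt (x^2 + y^2 + z^2) with hρ
    have hρ2 : ρ^2 = x^2 + y^2 + z^2 := Real.sq_sqrt hpos.le
    have hρ0 : 0 < ρ := Real.sqrt_pos.2 hpos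
    have hρa : IsAlgebraic ℚ ρ := by
      apply IsAlgebraic.of_pow (n := 2) (by norm_num)
      rw [hρ2]
      exact ((a1.pow 2).add (a2.pow 2)).add (a3.pow 2)
    refine ⟨⟨0, x/ρ, y/ρ, z/ρ⟩, ⟨isAlgebraic_zero, ?_, ?_, ?_⟩, rfl, ?_, ?_⟩
    · change IsAlgebraic ℚ (x/ρ); rw [div_eq_mul_inv]; exact a1.mul hρa.inv
    · change IsAlgebraic ℚ (y/ρ); rw [div_eq_mul_inv]; exact a2.mul hρa.inv
    · change IsAlgebraic ℚ (z/ρ); rw [div_eq_mul_inv]; exact a3.mul hρa.inv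
    · change (x/ρ)^2 + (y/ρ)^2 + (z/ρ)^2 = 1
      field_simp
      linarith
    · intro s hs
      obtain ⟨-, b1, b2, b3⟩ := hS s hs
      have hcs := hc s hs s0 hs0
      have c1 := congrArg (fun q : ℍ[ℝ] => q.imI) hcs
      have c2 := congrArg (fun q : ℍ[ℝ] => q.imJ) hcs
      have c3 := congrArg (fun q : ℍ[ℝ] => q.imK) hcs
      simp only [Quaternion.imI_mul, Quaternion.imJ_mul, Quaternion.imK_mul, ← hx, ← hy, ← hz] at c1 c2 c3
      have d1 : s.imJ * z = s.imK * y := by linarith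
      have d2 : s.imI * z = s.imK * x := by linarith
      have d3 : s.imI * y = s.imJ * x := by linarith
      refine ⟨(s.imI * x + s.imJ * y + s.imK * z) / ρ, ?_, ?_, ?_, ?_⟩
      · rw [div_eq_mul_inv]
        exact (((b1.mul a1).add (b2.mul a2)).add (b3.mul a3)).mul hρa.inv
      · change s.imI = _ * (x/ρ)
        field_simp
        rw [hρ2]
        linear_combination y * d3 + z * d2
      · change s.imJ = _ * (y/ρ)
        field_simp
        rw [hρ2]
        linear_combination - x * d3 + z * d1
      · change s.imK = _ * (z/ρ)
        field_simp
        rw [hρ2]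
        linear_combination - x * d2 - y * d1

lemma AlgQuat.mul_alg {p q : ℍ[ℝ]} (hp : AlgQuat p) (hq : AlgQuat q) : AlgQuat (p * q) := by
  obtain ⟨a1, a2, a3, a4⟩ := hp
  obtain ⟨b1, b2, b3, b4⟩ := hq
  refine ⟨?_, ?_, ?_, ?_⟩
  · rw [Quaternion.re_mul]
    exact (((a1.mul b1).sub (a2.mul b2)).sub (a3.mul b3)).sub (a4.mul b4)
  · rw [Quaternion.imI_mul]
    exact (((a1.mul b2).add (a2.mul b1)).add (a3.mul b4)).sub (a4.mul b3)
  · rw [Quaternion.imJ_mul]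
    exact (((a1.mul b3).sub (a2.mul b4)).add (a3.mul b1)).add (a4.mul b2)
  · rw [Quaternion.imK_mul]
    exact (((a1.mul b4).add (a2.mul b3)).sub (a3.mul b2)).add (a4.mul b1)

lemma AlgQuat.normSq_alg {p : ℍ[ℝ]} (hp : AlgQuat p) : IsAlgebraic ℚ (Quaternion.normSq p) := by
  obtain ⟨a1, a2, a3, a4⟩ := hp
  rw [Quaternion.normSq_def']
  exact (((a1.pow 2).add (a2.pow 2)).add (a3.pow 2)).add (a4.pow 2)

/-- Main Theorem 1.1: if `Γ₁, Γ₂` are semigroups of nonzero algebraic quaternions each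
generated by finitely many elements of norm greater than `1`, with `Γ₁` commutative, and
`a, a', b, b'` are nonzero algebraic quaternions, then the equation `a f a' + b g b' = 1`
has only finitely many solutions with `f ∈ Γ₁` and `g ∈ Γ₂`. -/
theorem quaternion_unit_equation (S₁ S₂ : Finset ℍ[ℝ])
    (hS₁ : ∀ g ∈ S₁, AlgQuat g ∧ 1 < ‖g‖) (hS₂ : ∀ g ∈ S₂, AlgQuat g ∧ 1 < ‖g‖)
    (hcomm : ∀ x ∈ Subsemigroup.closure (S₁ : Set ℍ[ℝ]),
      ∀ y ∈ Subsemigroup.closure (S₁ : Set ℍ[ℝ]), x * y = y * x)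
    (a a' b b' : ℍ[ℝ]) (ha : a ≠ 0) (ha' : a' ≠ 0) (hb : b ≠ 0) (hb' : b' ≠ 0)
    (haA : AlgQuat a) (haA' : AlgQuat a') (hbA : AlgQuat b) (hbA' : AlgQuat b') :
    {p : ℍ[ℝ] × ℍ[ℝ] | p.1 ∈ Subsemigroup.closure (S₁ : Set ℍ[ℝ]) ∧
      p.2 ∈ Subsemigroup.closure (S₂ : Set ℍ[ℝ]) ∧
      a * p.1 * a' + b * p.2 * b' = 1}.Finite := by
  obtain ⟨i0, hi0A, hi0re, hi0n, hi0⟩ := exists_i0 S₁ (fun g hg => (hS₁ g hg).1)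
    (fun x hx y hy => hcomm x (Subsemigroup.subset_closure hx) y (Subsemigroup.subset_closure hy))
  choose! y hya hy1 hy2 hy3 using hi0
  set ψ : ℂ → ℍ[ℝ] := fun z => ⟨z.re, z.im * i0.imI, z.im * i0.imJ, z.im * i0.imK⟩ with hψ
  have p0 : ∀ z, (ψ z).re = z.re := fun _ => rfl
  have p1 : ∀ z, (ψ z).imI = z.im * i0.imI := fun _ => rfl
  have p2 : ∀ z, (ψ z).imJ = z.im * i0.imJ := fun _ => rfl
  have p3 : ∀ z, (ψ z).imK = z.im * i0.imK := fun _ => rfl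
  have hψmul : ∀ z w, ψ (z*w) = ψ z * ψ w := by
    intro z w
    ext
    · rw [Quaternion.re_mul]; simp only [p0, p1, p2, p3, Complex.mul_re]
      linear_combination (z.im*w.im) * hi0n
    · rw [Quaternion.imI_mul]; simp only [p0, p1, p2, p3, Complex.mul_im]; ring
    · rw [Quaternion.imJ_mul]; simp only [p0, p1, p2, p3, Complex.mul_im]; ring
    · rw [Quaternion.imK_mul]; simp only [p0, p1, p2, p3, Complex.mul_im]; ring
  have hψn : ∀ z, Quaternion.normSq (ψ z) = ‖z‖^2 := by
    intro z
    rw [Quaternion.normSq_def', ← Complex.normSq_eq_norm_sq, Complex.normSq_apply]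
    simp only [p0, p1, p2, p3]
    linear_combination z.im^2 * hi0n
  set z : S₁ → ℂ := fun s => ⟨(s:ℍ[ℝ]).re, y s⟩ with hz
  have hψz : ∀ s : S₁, (s:ℍ[ℝ]) = ψ (z s) := by
    intro s
    ext
    · rfl
    · exact hy1 s s.2
    · exact hy2 s s.2
    · exact hy3 s s.2
  have hsq : ∀ g : ℍ[ℝ], 1 < ‖g‖ → 1 < Quaternion.normSq g := by
    intro g hg
    rw [Quaternion.normSq_eq_norm_mul_self]; nlinarith
  set p := a' * a with hp
  have hpA : AlgQuat p := haA'.mul_alg haA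
  have hpiA : AlgQuat (p * i0) := hpA.mul_alg hi0A
  have hpos : ∀ g : ℍ[ℝ], g ≠ 0 → 0 < Quaternion.normSq g := fun g hg =>
    lt_of_le_of_ne Quaternion.normSq_nonneg (Ne.symm (Quaternion.normSq_ne_zero.2 hg))
  have hfin := complex_part z (fun s : S₂ => Quaternion.normSq (s:ℍ[ℝ]))
    (Quaternion.normSq a * Quaternion.normSq a') (Quaternion.normSq b * Quaternion.normSq b')
    ⟨p.re, -(p*i0).re⟩ (fun s => (hS₁ s s.2).1.1) (fun s => hya s s.2)
    (fun s => by
      have h1 := hsq _ (hS₁ s s.2).2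
      rw [hψz s, hψn] at h1
      by_contra hcon
      push Not at hcon
      nlinarith [norm_nonneg (z s)])
    (fun s => (hS₂ s s.2).1.normSq_alg) (fun s => hsq _ (hS₂ s s.2).2)
    (mul_pos (hpos a ha) (hpos a' ha')) (mul_pos (hpos b hb) (hpos b' hb'))
    (haA.normSq_alg.mul haA'.normSq_alg) (hbA.normSq_alg.mul hbA'.normSq_alg) hpA.1 hpiA.1.neg
  apply (hfin.image (fun n => (ψ (∏ i, z i^n i), b⁻¹ * (1 - a * ψ (∏ i, z i^n i) * a') * b'⁻¹))).subset
  rintro ⟨f, g⟩ ⟨hf, hg, heq⟩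
  change a * f * a' + b * g * b' = 1 at heq
  obtain ⟨n, hn⟩ := closure_prod S₁ (fun x w => x = ψ w) z hψz
    (fun x y a b h1 h2 => by rw [h1, h2, hψmul]) f hf
  obtain ⟨m, hm⟩ := closure_prod S₂ (fun x w => Quaternion.normSq x = w)
    (fun s : S₂ => Quaternion.normSq (s:ℍ[ℝ])) (fun s => rfl)
    (fun x y a b h1 h2 => by rw [map_mul, h1, h2]) g hg
  replace hn : f = ψ (∏ i, z i^n i) := hn
  have heq2 : b * g * b' = 1 - a * f * a' := by rw [← heq]; abel
  refine ⟨n, ⟨m, ?_⟩, ?_⟩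
  · rw [← hm]
    set Z := ∏ i, z i^n i with hZ
    have h1 : Quaternion.normSq (b * g * b') = Quaternion.normSq (1 - a * f * a') := by rw [heq2]
    rw [map_mul, map_mul] at h1
    have h2 : Quaternion.normSq (1 - a * f * a') =
        1 + Quaternion.normSq (a * f * a') - 2 * (a * f * a').re := by
      simp only [Quaternion.normSq_def', Quaternion.re_sub, Quaternion.imI_sub, Quaternion.imJ_sub,
        Quaternion.imK_sub, Quaternion.re_one, Quaternion.imI_one, Quaternion.imJ_one, Quaternion.imK_one]
      ring
    have h3 : (a * f * a').re = ((⟨p.re, -(p*i0).re⟩ : ℂ) * Z).re := by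
      have e : (a * f * a').re = (a' * a * f).re := by
        simp only [Quaternion.re_mul, Quaternion.imI_mul, Quaternion.imJ_mul, Quaternion.imK_mul]; ring
      rw [e, ← hp, hn, Complex.mul_re]
      simp only [Quaternion.re_mul, p0, p1, p2, p3, hi0re]
      ring
    rw [h2, h3, map_mul, map_mul, hn, hψn] at h1
    linarith
  · simp only [Prod.mk.injEq]
    refine ⟨hn.symm, ?_⟩
    rw [← hn, ← heq2, mul_assoc b, inv_mul_cancel_left₀ hb, mul_inv_cancel_right₀ hb']
end

section
/- Let A be a division algebra over a field k. Then every solvable subgroup N of the multiplicative group A× is virtually abelian, i.e., N has an abelian subgroup of finite index. -/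
open scoped IsMulCommutative in
lemma aux_finite_roots {k A : Type*} [Field k] [DivisionRing A] [Algebra k A]
    (S : Set A) (hc : ∀ x ∈ S, ∀ y ∈ S, x * y = y * x) (p : Polynomial k) (hp : p ≠ 0)
    (hr : ∀ x ∈ S, Polynomial.aeval x p = 0) : S.Finite := by
  have := Algebra.isMulCommutative_adjoin k hc
  have hfin := Polynomial.rootSet_finite p (Algebra.adjoin k S)
  refine (hfin.image (Subtype.val)).subset ?_
  intro x hx
  refine ⟨⟨x, Algebra.subset_adjoin hx⟩, ?_, rfl⟩
  rw [Polynomial.mem_rootSet]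
  refine ⟨hp, ?_⟩
  apply Subtype.val_injective
  have := Polynomial.aeval_algHom_apply (Algebra.adjoin k S).val ⟨x, Algebra.subset_adjoin hx⟩ p
  simp only [Subalgebra.coe_val] at this
  rw [← this, hr x hx]
  rfl

lemma aux_aeval_conj {k A : Type*} [Field k] [DivisionRing A] [Algebra k A]
    (u : Aˣ) (a : A) (p : Polynomial k) (h : Polynomial.aeval a p = 0) :
    Polynomial.aeval ((u : A) * a * (↑u⁻¹ : A)) p = 0 := by
  have : Polynomial.aeval ((u : A) * a * (↑u⁻¹ : A)) p
      = (u : A) * Polynomial.aeval a p * (↑u⁻¹ : A) := by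
    induction p using Polynomial.induction_on' with
    | add p q hp hq => 
      have key : ∀ p : Polynomial k, Polynomial.aeval ((u : A) * a * (↑u⁻¹ : A)) p
        = (u : A) * Polynomial.aeval a p * (↑u⁻¹ : A) := by
        intro p
        induction p using Polynomial.induction_on' with
        | add p q hp hq => simp only [map_add, mul_add, add_mul, hp, hq]
        | monomial n c =>
          rw [Polynomial.aeval_monomial, Polynomial.aeval_monomial, Units.conj_pow,
            ← mul_assoc, ← mul_assoc, ← mul_assoc, Algebra.commutes c (u : A)]
      exact key _
    | monomial n c =>
      rw [Polynomial.aeval_monomial, Polynomial.aeval_monomial, Units.conj_pow,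
        ← mul_assoc, ← mul_assoc, ← mul_assoc, Algebra.commutes c (u : A)]
  rw [this, h]; simp

/-- finite conjugacy class implies central -/
lemma aux_fc {G : Type*} [Group G]
    (P : ∀ K : Subgroup G, K.FiniteIndex → ∀ g, (∀ x ∈ K, x * g = g * x) →
      g ∈ Subgroup.center G)
    (b : G) (hb : (Set.range fun g : G => g * b * g⁻¹).Finite) : b ∈ Subgroup.center G := by
  have h1 : (MulAction.stabilizer (ConjAct G) b).index ≠ 0 := by
    rw [MulAction.index_stabilizer]
    have : MulAction.orbit (ConjAct G) b = Set.range fun g : G => g * b * g⁻¹ := by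
      ext x
      constructor
      · rintro ⟨g, rfl⟩
        exact ⟨ConjAct.ofConjAct g, rfl⟩
      · rintro ⟨g, rfl⟩
        exact ⟨ConjAct.toConjAct g, rfl⟩
    rw [this]
    exact (Set.ncard_pos hb).2 ⟨_, 1, rfl⟩ |>.ne'
  rw [← Subgroup.index_comap_of_surjective _ (f := (ConjAct.toConjAct (G := G)).toMonoidHom)
    (ConjAct.toConjAct (G := G)).surjective] at h1
  refine P _ (Subgroup.finiteIndex_iff.2 h1) b ?_
  intro x hx
  have hx' : x * b * x⁻¹ = b := hx
  exact mul_inv_eq_iff_eq_mul.1 hx'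

lemma aux_abelian {k A G : Type*} [Field k] [DivisionRing A] [Algebra k A]
    [FiniteDimensional k A] [Group G] (f : G →* Aˣ) (hf : Function.Injective f)
    (P : ∀ K : Subgroup G, K.FiniteIndex → ∀ g, (∀ x ∈ K, x * g = g * x) →
      g ∈ Subgroup.center G)
    (B : Subgroup G) [hB : B.Normal] (hc : ∀ x ∈ B, ∀ y ∈ B, x * y = y * x) :
    B ≤ Subgroup.center G := by
  intro b hb
  apply aux_fc P
  have hinj : Function.Injective (fun g : G => ((f g : Aˣ) : A)) := fun x y h => hf (Units.ext h)
  apply Set.Finite.of_finite_image (f := fun g : G => ((f g : Aˣ) : A)) _ hinj.injOn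
  refine aux_finite_roots (k := k) _ ?_ (minpoly k ((f b : Aˣ) : A))
    (minpoly.ne_zero (Algebra.IsIntegral.isIntegral _)) ?_
  · rintro _ ⟨_, ⟨g, rfl⟩, rfl⟩ _ ⟨_, ⟨h, rfl⟩, rfl⟩
    have := hc _ (hB.conj_mem b hb g) _ (hB.conj_mem b hb h)
    simp only [← Units.val_mul, ← map_mul, this]
  · rintro _ ⟨_, ⟨g, rfl⟩, rfl⟩
    have := aux_aeval_conj (f g) (f b : A) _ (minpoly.aeval k ((f b : Aˣ) : A))
    simpa using this

open scoped commutatorElement in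
lemma aux_indep {A G : Type*} [DivisionRing A] [Group G] (f : G →* Aˣ)
    (hf : Function.Injective f) (B : Subgroup G)
    (hBB : ∀ x ∈ B, ∀ y ∈ B, ⁅x, y⁆ ∈ Subgroup.center G)
    (hZ : ∀ b ∈ B, (∀ x ∈ B, x * b = b * x) → b ∈ Subgroup.center G)
    {ι : Type*} (v : ι → G) (hvB : ∀ i, v i ∈ B)
    (hv : ∀ i j, i ≠ j → (v i)⁻¹ * v j ∉ Subgroup.center G) (s : Finset ι) :
    ∀ c : ι → A, (∀ i, ∀ x ∈ B, (f x : A) * c i = c i * f x) →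
      ∑ i ∈ s, c i * f (v i) = 0 → ∀ i ∈ s, c i = 0 := by
  classical
  induction s using Finset.induction_on with
  | empty => simp
  | insert j s hj ih =>
    intro c hc hsum
    have hs : ∀ i ∈ s, c i = 0 := by
      intro i hi
      have hij : i ≠ j := fun h => hj (h ▸ hi)
      -- find x separating
      obtain ⟨x, hx, hne⟩ : ∃ x ∈ B, ⁅x, v i⁆ ≠ ⁅x, v j⁆ := by
        by_contra hcon
        push Not at hcon
        apply hv i j hij
        apply hZ _ (B.mul_mem (B.inv_mem (hvB i)) (hvB j))
        intro x hx
        have h1 := hcon x hx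
        have h2 : x * v i * x⁻¹ = ⁅x, v i⁆ * v i := by simp [commutatorElement_def]
        have h3 : x * v j * x⁻¹ = ⁅x, v i⁆ * v j := by rw [h1]; simp [commutatorElement_def]
        have h4 : x * ((v i)⁻¹ * v j) * x⁻¹ = (v i)⁻¹ * v j := by
          calc x * ((v i)⁻¹ * v j) * x⁻¹ = (x * v i * x⁻¹)⁻¹ * (x * v j * x⁻¹) := by group
            _ = _ := by rw [h2, h3]; group
        exact mul_inv_eq_iff_eq_mul.1 h4
      have hz : ∀ l, ∀ g : G, (f g : A) * f ⁅x, v l⁆ = f ⁅x, v l⁆ * f g := by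
        intro l g
        have := Subgroup.mem_center_iff.1 (hBB x hx _ (hvB l)) g
        rw [← Units.val_mul, ← Units.val_mul, ← map_mul, ← map_mul, this]
      have key := ih (fun l => c l * ((f ⁅x, v l⁆ : A) - f ⁅x, v j⁆)) ?_ ?_ i hi
      · rcases mul_eq_zero.1 key with h | h
        · exact h
        · exact absurd (hf (Units.ext (sub_eq_zero.1 h))) hne
      · intro l y hy
        rw [← mul_assoc, hc l y hy, mul_assoc, mul_assoc, mul_sub, sub_mul, hz, hz]
      · have e1 : ∑ l ∈ insert j s, c l * (f ⁅x, v l⁆ : A) * f (v l) = 0 := by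
          have : ∀ l, c l * (f ⁅x, v l⁆ : A) * f (v l)
              = (f x : A) * (c l * f (v l)) * f x⁻¹ := by
            intro l
            rw [← mul_assoc, hc l x hx, mul_assoc, mul_assoc, mul_assoc]
            congr 1
            simp only [← Units.val_mul, ← map_mul]
            congr 2
            simp [commutatorElement_def, mul_assoc]
          simp only [this, ← Finset.sum_mul, ← Finset.mul_sum, hsum]
          simp
        have e2 : ∑ l ∈ insert j s, c l * (f ⁅x, v j⁆ : A) * f (v l) = 0 := by
          have : ∀ l, c l * (f ⁅x, v j⁆ : A) * f (v l)
              = (c l * f (v l)) * f ⁅x, v j⁆ := by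
            intro l
            rw [mul_assoc, mul_assoc, hz]
          simp only [this, ← Finset.sum_mul, hsum]
          simp
        rw [Finset.sum_insert hj] at e1 e2
        simp only [mul_sub, sub_mul, Finset.sum_sub_distrib]
        rw [eq_neg_of_add_eq_zero_right e1, eq_neg_of_add_eq_zero_right e2, sub_self]
    intro i hi
    rcases Finset.mem_insert.1 hi with rfl | h
    · rw [Finset.sum_insert hj, Finset.sum_eq_zero (fun l hl => by rw [hs l hl, zero_mul]),
        add_zero] at hsum
      exact (mul_eq_zero.1 hsum).resolve_right (Units.ne_zero _)
    · exact hs i h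

lemma aux_step {k A G : Type*} [Field k] [DivisionRing A] [Algebra k A]
    [FiniteDimensional k A] [Group G] (f : G →* Aˣ) (hf : Function.Injective f)
    (P : ∀ K : Subgroup G, K.FiniteIndex → ∀ g, (∀ x ∈ K, x * g = g * x) →
      g ∈ Subgroup.center G)
    (B : Subgroup G) [hB : B.Normal] (hBB : ⁅B, B⁆ ≤ Subgroup.center G) :
    B ≤ Subgroup.center G := by
  rw [Subgroup.commutator_le] at hBB
  have hZ : ∀ b ∈ B, (∀ x ∈ B, x * b = b * x) → b ∈ Subgroup.center G := by
    have h := aux_abelian (k := k) f hf P (B ⊓ Subgroup.centralizer (B : Set G)) (by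
      intro x hx y hy
      exact (Subgroup.mem_centralizer_iff.1 hx.2 y hy.1).symm)
    intro b hb hb'
    exact h ⟨hb, Subgroup.mem_centralizer_iff.2 hb'⟩
  -- finiteness of the image of B modulo center
  let q : G → G ⧸ Subgroup.center G := QuotientGroup.mk
  have hfin : (q '' (B : Set G)).Finite := by
    choose v hvB hv using fun i : (q '' (B : Set G)) => i.2
    have hli : LinearIndependent k (fun i => ((f (v i) : Aˣ) : A)) := by
      rw [linearIndependent_iff']
      intro s c hsum i hi
      have := aux_indep f hf B hBB hZ v hvB (by
        intro i j hij hmem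
        apply hij
        apply Subtype.ext
        rw [← hv i, ← hv j]
        exact QuotientGroup.eq.2 hmem) s (fun i => algebraMap k A (c i))
        (fun i x _ => (Algebra.commutes _ _).symm)
        (by simpa only [Algebra.smul_def] using hsum) i hi
      exact (map_eq_zero _).1 this
    exact Set.finite_coe_iff.1 hli.finite
  intro b hb
  obtain ⟨n, hn, hbn⟩ : ∃ n : ℕ, 0 < n ∧ b ^ n ∈ Subgroup.center G := by
    have hni : ¬ Set.InjOn (fun n : ℕ => q (b ^ n)) Set.univ := by
      intro hinj
      exact Set.infinite_univ ((hfin.subset (by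
        rintro _ ⟨n, -, rfl⟩
        exact ⟨b ^ n, B.pow_mem hb n, rfl⟩)).of_finite_image hinj)
    obtain ⟨i, j, hlt, hij⟩ : ∃ i j : ℕ, i < j ∧ q (b ^ i) = q (b ^ j) := by
      by_contra hcon
      push Not at hcon
      apply hni
      intro i _ j _ hij
      rcases lt_trichotomy i j with h | h | h
      · exact absurd hij (hcon _ _ h)
      · exact h
      · exact absurd hij.symm (hcon _ _ h)
    refine ⟨j - i, by omega, ?_⟩
    have := QuotientGroup.eq.1 hij
    rwa [show b ^ j = b ^ i * b ^ (j - i) by rw [← pow_add]; congr 1; omega,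
      inv_mul_cancel_left] at this
  have hroots : {z : G | z ∈ Subgroup.center G ∧ z ^ n = 1}.Finite := by
    have hinj : Function.Injective (fun g : G => ((f g : Aˣ) : A)) :=
      fun x y h => hf (Units.ext h)
    apply Set.Finite.of_finite_image (f := fun g : G => ((f g : Aˣ) : A)) _ hinj.injOn
    refine aux_finite_roots (k := k) _ ?_ (Polynomial.X ^ n - 1)
      (Polynomial.X_pow_sub_C_ne_zero hn 1) ?_
    · rintro _ ⟨x, hx, rfl⟩ _ ⟨y, hy, rfl⟩
      simp only [← Units.val_mul, ← map_mul, Subgroup.mem_center_iff.1 hy.1 x]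
    · rintro _ ⟨x, hx, rfl⟩
      have h1 : ((f x : Aˣ) : A) ^ n = 1 := by
        rw [← Units.val_pow_eq_pow_val, ← map_pow, hx.2]; simp
      simp [map_pow, h1]
  apply aux_fc P
  have hpow : ∀ g : G, (g * b * g⁻¹) ^ n = b ^ n := by
    intro g
    rw [conj_pow, Subgroup.mem_center_iff.1 hbn g, mul_inv_cancel_right]
  apply Set.Finite.of_finite_fibers q
  · apply hfin.subset
    rintro _ ⟨_, ⟨g, rfl⟩, rfl⟩
    exact ⟨_, hB.conj_mem b hb g, rfl⟩
  · rintro _ ⟨_, ⟨g, rfl⟩, rfl⟩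
    refine (hroots.image (fun z => (g * b * g⁻¹) * z)).subset ?_
    rintro _ ⟨⟨h, rfl⟩, hh⟩
    have hz : (g * b * g⁻¹)⁻¹ * (h * b * h⁻¹) ∈ Subgroup.center G :=
      QuotientGroup.eq.1 (Eq.symm hh)
    refine ⟨_, ⟨hz, ?_⟩, mul_inv_cancel_left _ _⟩
    have hcm : Commute (g * b * g⁻¹) ((g * b * g⁻¹)⁻¹ * (h * b * h⁻¹)) :=
      Subgroup.mem_center_iff.1 hz _
    have := hcm.mul_pow n
    rw [mul_inv_cancel_left, hpow, hpow] at this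
    exact (mul_eq_left.1 this.symm)

/-- Every solvable subgroup of the multiplicative group of a finite-dimensional division
algebra over a field is virtually abelian: it has an abelian subgroup of finite index. -/
theorem solvable_subgroup_virtually_abelian
    (k : Type*) [Field k] (A : Type*) [DivisionRing A] [Algebra k A]
    [FiniteDimensional k A]
    (N : Subgroup Aˣ) (hN : IsSolvable N) :
    ∃ H : Subgroup N, H.FiniteIndex ∧ ∀ x y : H, x * y = y * x := by
  classical
  let C : Subgroup N → Subalgebra k A := fun H =>
    Subalgebra.centralizer k ((fun g : N => ((g : Aˣ) : A)) '' (H : Set N))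
  obtain ⟨H, hH, hmax⟩ : ∃ H : Subgroup N, H.FiniteIndex ∧ ∀ K : Subgroup N, K.FiniteIndex →
      Module.finrank k (C K) ≤ Module.finrank k (C H) := by
    let S : Set ℕ := {d | ∃ H : Subgroup N, H.FiniteIndex ∧ Module.finrank k (C H) = d}
    have hne : S.Nonempty := ⟨_, ⊤, inferInstance, rfl⟩
    have hbd : BddAbove S := by
      refine ⟨Module.finrank k A, ?_⟩
      rintro _ ⟨H, _, rfl⟩
      exact Submodule.finrank_le (Subalgebra.toSubmodule (C H))
    obtain ⟨H, hH, hd⟩ := Nat.sSup_mem hne hbd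
    exact ⟨H, hH, fun K hK => hd ▸ le_csSup hbd ⟨K, hK, rfl⟩⟩
  refine ⟨H, hH, ?_⟩
  let f : H →* Aˣ := N.subtype.comp H.subtype
  have hf : Function.Injective f := N.subtype_injective.comp H.subtype_injective
  have P : ∀ K : Subgroup H, K.FiniteIndex → ∀ g, (∀ x ∈ K, x * g = g * x) →
      g ∈ Subgroup.center H := by
    intro K hK g hg
    have hK' : (K.map H.subtype).FiniteIndex := by
      rw [Subgroup.finiteIndex_iff, Subgroup.index_map_subtype]
      exact mul_ne_zero hK.index_ne_zero hH.index_ne_zero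
    have hle : C H ≤ C (K.map H.subtype) := by
      apply Subalgebra.centralizer_le
      apply Set.image_mono
      rintro _ ⟨x, _, rfl⟩
      exact x.2
    have heq := Submodule.eq_of_le_of_finrank_le
      (S₁ := Subalgebra.toSubmodule (C H)) (S₂ := Subalgebra.toSubmodule (C (K.map H.subtype)))
      hle (hmax _ hK')
    have hmem : ((f g : Aˣ) : A) ∈ Subalgebra.toSubmodule (C (K.map H.subtype)) := by
      rw [Subalgebra.mem_toSubmodule, Subalgebra.mem_centralizer_iff]
      rintro _ ⟨_, ⟨x, hx, rfl⟩, rfl⟩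
      have := congrArg (fun y => ((f y : Aˣ) : A)) (hg x hx)
      simp only [map_mul, Units.val_mul] at this
      exact this
    rw [← heq, Subalgebra.mem_toSubmodule, Subalgebra.mem_centralizer_iff] at hmem
    rw [Subgroup.mem_center_iff]
    intro x
    apply hf
    apply Units.ext
    have := hmem _ ⟨x, x.2, rfl⟩
    simp only [map_mul, Units.val_mul]
    exact this
  have hN2 : Group.IsSolvable N := hN
  obtain ⟨n, hn⟩ := (Group.isSolvable_def H).1 inferInstance
  have hall : ∀ m, derivedSeries H (n - m) ≤ Subgroup.center H := by
    intro m
    induction m with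
    | zero => simp [hn]
    | succ m ih =>
      rcases Nat.lt_or_ge m n with h | h
      · rw [show n - m = (n - (m + 1)) + 1 by omega, derivedSeries_succ] at ih
        exact aux_step (k := k) f hf P _ ih
      · rwa [show n - (m + 1) = n - m by omega]
  have htop := hall n
  rw [Nat.sub_self, derivedSeries_zero] at htop
  intro x y
  exact Subgroup.mem_center_iff.1 (htop (Subgroup.mem_top y)) x
end
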